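/- arXiv:2506.21470 — 11 statements merged into one kernel-verified Lean document; each statement's English description precedes it below -/
import Mathlib

section
/- The set function f is submodular: for all subsets A ⊆ B ⊆ 𝒯 and every j ∈ 𝒯 \ B, it holds that f(A ∪ {j}) − f(A) ≥ f(B ∪ {j}) − f(B). -/
/-- Parameters for the single-window storage problem. -/
structure BatParams where
  Δ : ℝ
  ηc : ℝ
  ηd : ℝ
  Sl : ℝ
  Su : ℝ
  Pce : ℝ
  Pde : ℝ
  sstar : ℝ

namespace BatParams

/-- The feasible set `𝒫_{τ̄}(Ω)`, with `s 0 = s*` playing the role of `s_{-1}`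
and `s (τ+1)` playing the role of `s_τ`. -/
def Feas (π : BatParams) (tb : ℕ) (Ω : Finset ℕ) (pd pc s : ℕ → ℝ) : Prop :=
  s 0 = π.sstar ∧ ∀ τ, τ ≤ tb →
    0 ≤ pd τ ∧ pd τ ≤ π.Pde ∧ 0 ≤ pc τ ∧ pc τ ≤ π.Pce ∧
    π.Sl ≤ s (τ + 1) ∧ s (τ + 1) ≤ π.Su ∧
    s (τ + 1) = s τ + π.Δ * (π.ηc * pc τ - pd τ / π.ηd) ∧
    (τ ∈ Ω → pd τ = 0) ∧ (τ ∉ Ω → pc τ = 0)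

/-- `f(Ω)`: maximal cumulative charging power over `𝒫_{τ̄}(Ω)`. -/
noncomputable def f (π : BatParams) (tb : ℕ) (Ω : Finset ℕ) : ℝ :=
  sSup {x : ℝ | ∃ pd pc s : ℕ → ℝ,
    π.Feas tb Ω pd pc s ∧ x = ∑ τ ∈ Finset.range (tb + 1), pc τ}

/-- `g(Ω)`: maximal cumulative discharging power over `𝒫_{τ̄}(𝒯 \ Ω)`. -/
noncomputable def g (π : BatParams) (tb : ℕ) (Ω : Finset ℕ) : ℝ :=
  sSup {x : ℝ | ∃ pd pc s : ℕ → ℝ,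
    π.Feas tb (Finset.range (tb + 1) \ Ω) pd pc s ∧
      x = ∑ τ ∈ Finset.range (tb + 1), pd τ}

/-- The greedy state-of-charge trajectory: `σtraj Ω (τ+1)` is `σ_τ(Ω)` and
`σtraj Ω 0 = σ_{-1}(Ω) = s*`. -/
noncomputable def σtraj (π : BatParams) (Ω : Finset ℕ) : ℕ → ℝ
  | 0 => π.sstar
  | τ + 1 =>
      if τ ∈ Ω then min (π.σtraj Ω τ + π.Δ * π.ηc * π.Pce) π.Su
      else max (π.σtraj Ω τ - π.Δ * π.Pde / π.ηd) π.Sl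

end BatParams

namespace BatParams

/-- The state of charge after one period of greedy charging. -/
noncomputable def chargeStep (π : BatParams) (s : ℝ) : ℝ :=
  min (s + π.Δ * π.ηc * π.Pce) π.Su

/-- The state of charge after one period of greedy discharging. -/
noncomputable def dischargeStep (π : BatParams) (s : ℝ) : ℝ :=
  max (s - π.Δ * π.Pde / π.ηd) π.Sl

/-- The energy charged by the greedy policy over the `n` periods `t, …, t + n - 1`
when the state of charge before period `t` is `s`. -/
noncomputable def greedyCharge (π : BatParams) (Ω : Finset ℕ) : ℕ → ℕ → ℝ → ℝ
  | 0, _, _ => 0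
  | n + 1, t, s =>
      if t ∈ Ω then π.chargeStep s - s + π.greedyCharge Ω n (t + 1) (π.chargeStep s)
      else π.greedyCharge Ω n (t + 1) (π.dischargeStep s)

section Greedy

variable {π : BatParams}

lemma chargeStep_mono {s s' : ℝ} (h : s ≤ s') : π.chargeStep s ≤ π.chargeStep s' :=
  min_le_min_right _ (by linarith)

lemma dischargeStep_mono {s s' : ℝ} (h : s ≤ s') :
    π.dischargeStep s ≤ π.dischargeStep s' :=
  max_le_max_right _ (by linarith)

lemma le_chargeStep (hc : 0 ≤ π.Δ * π.ηc * π.Pce) {s : ℝ} (hs : s ∈ Set.Icc π.Sl π.Su) :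
    s ≤ π.chargeStep s :=
  le_min (by linarith) hs.2

lemma dischargeStep_le (hd : 0 ≤ π.Δ * π.Pde / π.ηd) {s : ℝ}
    (hs : s ∈ Set.Icc π.Sl π.Su) : π.dischargeStep s ≤ s :=
  max_le (by linarith) hs.1

lemma chargeStep_mem (hc : 0 ≤ π.Δ * π.ηc * π.Pce) {s : ℝ}
    (hs : s ∈ Set.Icc π.Sl π.Su) : π.chargeStep s ∈ Set.Icc π.Sl π.Su :=
  ⟨hs.1.trans (le_chargeStep hc hs), min_le_right _ _⟩

lemma dischargeStep_mem (hd : 0 ≤ π.Δ * π.Pde / π.ηd) {s : ℝ}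
    (hs : s ∈ Set.Icc π.Sl π.Su) : π.dischargeStep s ∈ Set.Icc π.Sl π.Su :=
  ⟨le_max_right _ _, (dischargeStep_le hd hs).trans hs.2⟩

lemma dischargeStep_le_chargeStep (hc : 0 ≤ π.Δ * π.ηc * π.Pce)
    (hd : 0 ≤ π.Δ * π.Pde / π.ηd) {q p : ℝ} (hq : q ∈ Set.Icc π.Sl π.Su)
    (hp : p ∈ Set.Icc π.Sl π.Su) (hqp : q ≤ p) : π.dischargeStep q ≤ π.chargeStep p :=
  (dischargeStep_le hd hq).trans (hqp.trans (le_chargeStep hc hp))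

lemma chargeStep_sub_le {s s' : ℝ} (h : s ≤ s') :
    π.chargeStep s' - π.chargeStep s ≤ s' - s := by
  unfold chargeStep
  grind

lemma dischargeStep_sub_le {s s' : ℝ} (h : s ≤ s') :
    π.dischargeStep s' - π.dischargeStep s ≤ s' - s := by
  unfold dischargeStep
  grind

lemma chargeStep_sub_lower {q q' p p' : ℝ} (hq : q ≤ q') (hp : p ≤ p') (hqp : q ≤ p)
    (hqp' : q' ≤ p') :
    q' - q - (π.chargeStep q' - π.chargeStep q) ≤
      max (p' - p) (q' - q) - (π.chargeStep p' - π.chargeStep p) := by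
  unfold chargeStep
  grind

lemma dischargeStep_sub_diff {q q' p p' : ℝ} (hq : q ≤ q') (hp : p ≤ p') (hqp : q ≤ p)
    (hqp' : q' ≤ p') :
    π.dischargeStep q' - π.dischargeStep q - (π.dischargeStep p' - π.dischargeStep p) ≤
      max 0 (q' - q - (p' - p)) := by
  unfold dischargeStep
  grind

/-- The greedy charge lost by raising the initial level grows with the level and with the
set of charging periods. -/
lemma greedyCharge_loss_le (hc : 0 ≤ π.Δ * π.ηc * π.Pce) (hd : 0 ≤ π.Δ * π.Pde / π.ηd)
    {A B : Finset ℕ} (hAB : A ⊆ B) (n t : ℕ) {q q' p p' : ℝ}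
    (hqm : q ∈ Set.Icc π.Sl π.Su) (hqm' : q' ∈ Set.Icc π.Sl π.Su)
    (hpm : p ∈ Set.Icc π.Sl π.Su) (hpm' : p' ∈ Set.Icc π.Sl π.Su)
    (hq : q ≤ q') (hp : p ≤ p') (hqp : q ≤ p) (hqp' : q' ≤ p') :
    π.greedyCharge A n t q - π.greedyCharge A n t q' ≤
      π.greedyCharge B n t p - π.greedyCharge B n t p' + max 0 (q' - q - (p' - p)) := by
  induction n generalizing t q q' p p' with
  | zero => simp [greedyCharge]
  | succ n ih =>
    by_cases hB : t ∈ B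
    · have hTp := chargeStep_sub_le (π := π) hp
      by_cases hA : t ∈ A
      · have key := ih (t + 1) (chargeStep_mem hc hqm) (chargeStep_mem hc hqm')
          (chargeStep_mem hc hpm) (chargeStep_mem hc hpm') (chargeStep_mono hq)
          (chargeStep_mono hp) (chargeStep_mono hqp) (chargeStep_mono hqp')
        have hT := chargeStep_sub_lower (π := π) hq hp hqp hqp'
        simp only [greedyCharge, hA, hB, if_true]
        grind
      · have key := ih (t + 1) (dischargeStep_mem hd hqm) (dischargeStep_mem hd hqm')
          (chargeStep_mem hc hpm) (chargeStep_mem hc hpm') (dischargeStep_mono hq)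
          (chargeStep_mono hp) (dischargeStep_le_chargeStep hc hd hqm hpm hqp)
          (dischargeStep_le_chargeStep hc hd hqm' hpm' hqp')
        have hD := dischargeStep_sub_le (π := π) hq
        simp only [greedyCharge, hA, hB, if_true, if_false]
        grind
    · have hA : t ∉ A := fun h => hB (hAB h)
      have key := ih (t + 1) (dischargeStep_mem hd hqm) (dischargeStep_mem hd hqm')
        (dischargeStep_mem hd hpm) (dischargeStep_mem hd hpm') (dischargeStep_mono hq)
        (dischargeStep_mono hp) (dischargeStep_mono hqp) (dischargeStep_mono hqp')
      have hD := dischargeStep_sub_diff (π := π) hq hp hqp hqp'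
      simp only [greedyCharge, hA, hB, if_false]
      grind

lemma greedyCharge_sub_le (hc : 0 ≤ π.Δ * π.ηc * π.Pce) (hd : 0 ≤ π.Δ * π.Pde / π.ηd)
    (Ω : Finset ℕ) (n t : ℕ) {q q' : ℝ} (hqm : q ∈ Set.Icc π.Sl π.Su)
    (hqm' : q' ∈ Set.Icc π.Sl π.Su) (hq : q ≤ q') :
    π.greedyCharge Ω n t q - π.greedyCharge Ω n t q' ≤ q' - q := by
  have hU : π.Su ∈ Set.Icc π.Sl π.Su := ⟨hqm.1.trans hqm.2, le_rfl⟩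
  have h := greedyCharge_loss_le hc hd (Finset.Subset.refl Ω) n t hqm hqm' hU hU hq le_rfl
    hqm.2 hqm'.2
  grind

lemma greedyCharge_antitoneOn (hc : 0 ≤ π.Δ * π.ηc * π.Pce)
    (hd : 0 ≤ π.Δ * π.Pde / π.ηd) (Ω : Finset ℕ) (n t : ℕ) :
    AntitoneOn (π.greedyCharge Ω n t) (Set.Icc π.Sl π.Su) := by
  intro q hqm q' hqm' hq
  have hL : π.Sl ∈ Set.Icc π.Sl π.Su := ⟨le_rfl, hqm.1.trans hqm.2⟩
  have h := greedyCharge_loss_le hc hd (Finset.Subset.refl Ω) n t hL hL hqm hqm' le_rfl hq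
    hqm.1 hqm'.1
  grind

lemma greedyCharge_insert_of_lt (Ω : Finset ℕ) {j : ℕ} (n : ℕ) {t : ℕ} (hjt : j < t) (s : ℝ) :
    π.greedyCharge (insert j Ω) n t s = π.greedyCharge Ω n t s := by
  induction n generalizing t s with
  | zero => rfl
  | succ n ih =>
    simp only [greedyCharge, Finset.mem_insert, hjt.ne', false_or, ih (hjt.trans t.lt_succ_self)]

/-- Marginal gains of the greedy charge decrease with the level and with the set of charging
periods. -/
lemma greedyCharge_marginal_le (hc : 0 ≤ π.Δ * π.ηc * π.Pce)
    (hd : 0 ≤ π.Δ * π.Pde / π.ηd) {A B : Finset ℕ} (hAB : A ⊆ B) {j : ℕ} (hjB : j ∉ B)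
    (n t : ℕ) {q p : ℝ} (hqm : q ∈ Set.Icc π.Sl π.Su) (hpm : p ∈ Set.Icc π.Sl π.Su)
    (hqp : q ≤ p) :
    π.greedyCharge (insert j B) n t p - π.greedyCharge B n t p ≤
      π.greedyCharge (insert j A) n t q - π.greedyCharge A n t q := by
  induction n generalizing t q p with
  | zero => simp [greedyCharge]
  | succ n ih =>
    by_cases htj : t = j
    · subst htj
      have hA : t ∉ A := fun h => hjB (hAB h)
      have key := greedyCharge_loss_le hc hd (Finset.Subset.refl A) n (t + 1)
        (dischargeStep_mem hd hqm) (dischargeStep_mem hd hpm) (chargeStep_mem hc hqm) (chargeStep_mem hc hpm)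
        (dischargeStep_mono hqp) (chargeStep_mono hqp)
        (dischargeStep_le_chargeStep hc hd hqm hqm le_rfl)
        (dischargeStep_le_chargeStep hc hd hpm hpm le_rfl)
      have hset := greedyCharge_loss_le hc hd hAB n (t + 1) (dischargeStep_mem hd hpm)
        (chargeStep_mem hc hpm) (dischargeStep_mem hd hpm) (chargeStep_mem hc hpm)
        (dischargeStep_le_chargeStep hc hd hpm hpm le_rfl)
        (dischargeStep_le_chargeStep hc hd hpm hpm le_rfl) le_rfl le_rfl
      have hT := chargeStep_sub_le (π := π) hqp
      have hD := dischargeStep_sub_le (π := π) hqp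
      simp only [greedyCharge, hA, hjB, if_false, Finset.mem_insert_self, if_true,
        greedyCharge_insert_of_lt _ n t.lt_succ_self]
      grind
    · by_cases hB : t ∈ B
      · by_cases hA : t ∈ A
        · have key := ih (t + 1) (chargeStep_mem hc hqm) (chargeStep_mem hc hpm)
            (chargeStep_mono hqp)
          simp only [greedyCharge, Finset.mem_insert, htj, false_or, hA, hB, if_true]
          linarith
        · have key := ih (t + 1) (dischargeStep_mem hd hqm) (chargeStep_mem hc hpm)
            (dischargeStep_le_chargeStep hc hd hqm hpm hqp)
          simp only [greedyCharge, Finset.mem_insert, htj, false_or, hA, hB, if_true, if_false]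
          linarith
      · have hA : t ∉ A := fun h => hB (hAB h)
        have key := ih (t + 1) (dischargeStep_mem hd hqm) (dischargeStep_mem hd hpm)
          (dischargeStep_mono hqp)
        simp only [greedyCharge, Finset.mem_insert, htj, false_or, hA, hB, if_false]
        linarith

/-- Along every feasible profile, the charged energy is at most that of the greedy policy. -/
lemma Feas.sum_le_greedyCharge (hc : 0 ≤ π.Δ * π.ηc * π.Pce)
    (hd : 0 ≤ π.Δ * π.Pde / π.ηd) (hΔ : 0 < π.Δ) (hηc : 0 < π.ηc) (hηd : 0 < π.ηd)
    (hs : π.sstar ∈ Set.Icc π.Sl π.Su) {tb : ℕ} {Ω : Finset ℕ} {pd pc s : ℕ → ℝ}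
    (h : π.Feas tb Ω pd pc s) (n t : ℕ) (hn : n + t = tb + 1) :
    π.Δ * π.ηc * ∑ i ∈ Finset.range n, pc (t + i) ≤ π.greedyCharge Ω n t (s t) := by
  obtain ⟨h0, hstep⟩ := h
  have hmem : ∀ τ, τ ≤ tb + 1 → s τ ∈ Set.Icc π.Sl π.Su := by
    rintro (_ | τ) hτ
    · rwa [h0]
    · obtain ⟨-, -, -, -, hl, hu, -⟩ := hstep τ (by omega)
      exact ⟨hl, hu⟩
  induction n generalizing t with
  | zero => simp [greedyCharge]
  | succ n ih =>
    have key := ih (t + 1) (by omega)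
    obtain ⟨hpd0, hpd, hpc0, hpc, hl, hu, hrec, hΩ, hΩ'⟩ := hstep t (by omega)
    have hst := hmem t (by omega)
    have hst' := hmem (t + 1) (by omega)
    have hsum : ∑ i ∈ Finset.range (n + 1), pc (t + i) =
        ∑ i ∈ Finset.range n, pc (t + 1 + i) + pc t := by
      rw [Finset.sum_range_succ']
      simp [add_assoc, add_comm 1]
    rw [hsum]
    by_cases ht : t ∈ Ω
    · have hs1 : s (t + 1) = s t + π.Δ * π.ηc * pc t := by
        rw [hrec, hΩ ht]; ring
      have hle : s (t + 1) ≤ π.chargeStep (s t) := by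
        refine le_min ?_ hu
        rw [hs1]
        gcongr
      have := greedyCharge_sub_le hc hd Ω n (t + 1) hst' (chargeStep_mem hc hst) hle
      simp only [greedyCharge, ht, if_true]
      linarith
    · have hs1 : s (t + 1) = s t - π.Δ * pd t / π.ηd := by
        rw [hrec, hΩ' ht]; ring
      have hle : π.dischargeStep (s t) ≤ s (t + 1) := by
        refine max_le ?_ hl
        rw [hs1]
        gcongr
      have := greedyCharge_antitoneOn hc hd Ω n (t + 1) (dischargeStep_mem hd hst) hst' hle
      simp only [greedyCharge, ht, if_false, hΩ' ht]
      linarith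

lemma σtraj_succ_of_mem {Ω : Finset ℕ} {τ : ℕ} (h : τ ∈ Ω) :
    π.σtraj Ω (τ + 1) = π.chargeStep (π.σtraj Ω τ) := by
  simp [σtraj, chargeStep, h]

lemma σtraj_succ_of_notMem {Ω : Finset ℕ} {τ : ℕ} (h : τ ∉ Ω) :
    π.σtraj Ω (τ + 1) = π.dischargeStep (π.σtraj Ω τ) := by
  simp [σtraj, dischargeStep, h]

lemma σtraj_mem (hc : 0 ≤ π.Δ * π.ηc * π.Pce) (hd : 0 ≤ π.Δ * π.Pde / π.ηd)
    (hs : π.sstar ∈ Set.Icc π.Sl π.Su) (Ω : Finset ℕ) (τ : ℕ) :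
    π.σtraj Ω τ ∈ Set.Icc π.Sl π.Su := by
  induction τ with
  | zero => exact hs
  | succ τ ih =>
    by_cases h : τ ∈ Ω
    · rw [σtraj_succ_of_mem h]
      exact chargeStep_mem hc ih
    · rw [σtraj_succ_of_notMem h]
      exact dischargeStep_mem hd ih

/-- The charging powers of the greedy policy. -/
noncomputable def greedyPc (π : BatParams) (Ω : Finset ℕ) (τ : ℕ) : ℝ :=
  if τ ∈ Ω then (π.σtraj Ω (τ + 1) - π.σtraj Ω τ) / (π.Δ * π.ηc) else 0

/-- The discharging powers of the greedy policy. -/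
noncomputable def greedyPd (π : BatParams) (Ω : Finset ℕ) (τ : ℕ) : ℝ :=
  if τ ∈ Ω then 0 else (π.σtraj Ω τ - π.σtraj Ω (τ + 1)) * π.ηd / π.Δ

lemma feas_greedy (hc : 0 ≤ π.Δ * π.ηc * π.Pce) (hd : 0 ≤ π.Δ * π.Pde / π.ηd)
    (hΔ : 0 < π.Δ) (hηc : 0 < π.ηc) (hηd : 0 < π.ηd) (hPc : 0 ≤ π.Pce) (hPd : 0 ≤ π.Pde)
    (hs : π.sstar ∈ Set.Icc π.Sl π.Su) (tb : ℕ) (Ω : Finset ℕ) :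
    π.Feas tb Ω (π.greedyPd Ω) (π.greedyPc Ω) (π.σtraj Ω) := by
  refine ⟨rfl, fun τ _ => ?_⟩
  have hτ := σtraj_mem hc hd hs Ω τ
  obtain ⟨hl, hu⟩ := σtraj_mem hc hd hs Ω (τ + 1)
  have hΔc : 0 < π.Δ * π.ηc := mul_pos hΔ hηc
  by_cases h : τ ∈ Ω
  · have hup : π.σtraj Ω τ ≤ π.σtraj Ω (τ + 1) := by
      rw [σtraj_succ_of_mem h]
      exact le_chargeStep hc hτ
    have hle : π.σtraj Ω (τ + 1) ≤ π.σtraj Ω τ + π.Δ * π.ηc * π.Pce := by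
      rw [σtraj_succ_of_mem h]
      exact min_le_left _ _
    simp only [greedyPd, greedyPc, h, if_true]
    refine ⟨le_rfl, hPd, div_nonneg (by linarith) hΔc.le, ?_, hl, hu, ?_, by simp, by simp⟩
    · rw [div_le_iff₀ hΔc]
      linarith
    · field_simp
      ring
  · have hdown : π.σtraj Ω (τ + 1) ≤ π.σtraj Ω τ := by
      rw [σtraj_succ_of_notMem h]
      exact dischargeStep_le hd hτ
    have hle : π.σtraj Ω τ - π.Δ * π.Pde / π.ηd ≤ π.σtraj Ω (τ + 1) := by
      rw [σtraj_succ_of_notMem h]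
      exact le_max_left _ _
    simp only [greedyPd, greedyPc, h, if_false]
    refine ⟨div_nonneg (mul_nonneg (by linarith) hηd.le) hΔ.le, ?_, le_rfl, hPc, hl, hu, ?_,
      by simp, by simp⟩
    · rw [div_le_iff₀ hΔ, ← le_div_iff₀ hηd, mul_comm π.Pde]
      linarith
    · field_simp
      ring

lemma sum_greedyPc (hΔ : 0 < π.Δ) (hηc : 0 < π.ηc) (Ω : Finset ℕ) (n t : ℕ) :
    π.Δ * π.ηc * ∑ i ∈ Finset.range n, π.greedyPc Ω (t + i) =
      π.greedyCharge Ω n t (π.σtraj Ω t) := by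
  induction n generalizing t with
  | zero => simp [greedyCharge]
  | succ n ih =>
    have key := ih (t + 1)
    have hsum : ∑ i ∈ Finset.range (n + 1), π.greedyPc Ω (t + i) =
        ∑ i ∈ Finset.range n, π.greedyPc Ω (t + 1 + i) + π.greedyPc Ω t := by
      rw [Finset.sum_range_succ']
      simp [add_assoc, add_comm 1]
    rw [hsum, mul_add, key]
    by_cases h : t ∈ Ω
    · simp only [greedyCharge, greedyPc, h, if_true, ← σtraj_succ_of_mem h]
      field_simp
      ring
    · simp only [greedyCharge, greedyPc, h, if_false, ← σtraj_succ_of_notMem h]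
      ring

lemma f_eq_greedyCharge (hΔ : 0 < π.Δ) (hηc : 0 < π.ηc) (hηd : 0 < π.ηd)
    (hPc : 0 ≤ π.Pce) (hPd : 0 ≤ π.Pde) (hs : π.sstar ∈ Set.Icc π.Sl π.Su)
    (tb : ℕ) (Ω : Finset ℕ) :
    π.f tb Ω = π.greedyCharge Ω (tb + 1) 0 π.sstar / (π.Δ * π.ηc) := by
  have hc : 0 ≤ π.Δ * π.ηc * π.Pce := by positivity
  have hd : 0 ≤ π.Δ * π.Pde / π.ηd := by positivity
  have hΔc : 0 < π.Δ * π.ηc := mul_pos hΔ hηc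
  refine IsGreatest.csSup_eq ⟨⟨π.greedyPd Ω, π.greedyPc Ω, π.σtraj Ω,
    feas_greedy hc hd hΔ hηc hηd hPc hPd hs tb Ω, ?_⟩, ?_⟩
  · rw [div_eq_iff hΔc.ne', mul_comm]
    simpa [σtraj] using (sum_greedyPc hΔ hηc Ω (tb + 1) 0).symm
  · rintro x ⟨pd, pc, s, h, rfl⟩
    rw [le_div_iff₀ hΔc, mul_comm]
    simpa [h.1] using h.sum_le_greedyCharge hc hd hΔ hηc hηd hs (tb + 1) 0 rfl

end Greedy

end BatParams

/-- The set function `f` of Proposition 1 is submodular. -/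
theorem f_submodular (π : BatParams) (tb : ℕ)
    (hΔ : 0 < π.Δ) (hηc : 0 < π.ηc) (hηc1 : π.ηc ≤ 1)
    (hηd : 0 < π.ηd) (hηd1 : π.ηd ≤ 1) (hS : π.Sl < π.Su)
    (hPc : 0 ≤ π.Pce) (hPd : 0 ≤ π.Pde)
    (hs1 : π.Sl ≤ π.sstar) (hs2 : π.sstar ≤ π.Su)
    (A B : Finset ℕ) (hAB : A ⊆ B) (hB : B ⊆ Finset.range (tb + 1))
    (j : ℕ) (hjT : j ∈ Finset.range (tb + 1)) (hjB : j ∉ B) :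
    π.f tb (insert j A) - π.f tb A ≥ π.f tb (insert j B) - π.f tb B := by
  have hs : π.sstar ∈ Set.Icc π.Sl π.Su := ⟨hs1, hs2⟩
  have hc : 0 ≤ π.Δ * π.ηc * π.Pce := by positivity
  have hd : 0 ≤ π.Δ * π.Pde / π.ηd := by positivity
  simp only [BatParams.f_eq_greedyCharge hΔ hηc hηd hPc hPd hs, ge_iff_le, ← sub_div]
  have := BatParams.greedyCharge_marginal_le hc hd hAB hjB (tb + 1) 0 hs hs le_rfl
  gcongr
end

section
/- The set function g is submodular: for all subsets A ⊆ B ⊆ 𝒯 and every j ∈ 𝒯 \ B, it holds that g(A ∪ {j}) − g(A) ≥ g(B ∪ {j}) − g(B). -/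
namespace BatParams

/-- The parameter constraints of the storage problem that the greedy analysis uses. -/
structure Admissible (π : BatParams) : Prop where
  Δ_pos : 0 < π.Δ
  ηc_pos : 0 < π.ηc
  ηd_pos : 0 < π.ηd
  Pce_nonneg : 0 ≤ π.Pce
  Pde_nonneg : 0 ≤ π.Pde
  Sl_le : π.Sl ≤ π.sstar
  le_Su : π.sstar ≤ π.Su

/-- The state of charge of the schedule that discharges as much as possible in the periods of `Ω`
and charges as much as possible in all others. -/
noncomputable def soc (π : BatParams) (Ω : Finset ℕ) : ℕ → ℝ
  | 0 => π.sstar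
  | τ + 1 =>
      if τ ∈ Ω then max (π.soc Ω τ - π.Δ * π.Pde / π.ηd) π.Sl
      else min (π.soc Ω τ + π.Δ * π.ηc * π.Pce) π.Su

/-- Energy withdrawn from the store by the greedy trajectory during the first `n` periods. -/
noncomputable def withdrawn (π : BatParams) (Ω : Finset ℕ) (n : ℕ) : ℝ :=
  ∑ τ ∈ Finset.range n, if τ ∈ Ω then π.soc Ω τ - π.soc Ω (τ + 1) else 0

variable {π : BatParams} {Ω A B : Finset ℕ} {n : ℕ}

lemma soc_succ_of_mem (h : n ∈ Ω) :
    π.soc Ω (n + 1) = max (π.soc Ω n - π.Δ * π.Pde / π.ηd) π.Sl := by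
  simp [soc, h]

lemma soc_succ_of_notMem (h : n ∉ Ω) :
    π.soc Ω (n + 1) = min (π.soc Ω n + π.Δ * π.ηc * π.Pce) π.Su := by
  simp [soc, h]

lemma withdrawn_succ_of_mem (h : n ∈ Ω) :
    π.withdrawn Ω (n + 1) = π.withdrawn Ω n + (π.soc Ω n - π.soc Ω (n + 1)) := by
  rw [withdrawn, withdrawn, Finset.sum_range_succ]; simp only [h, if_true]

lemma withdrawn_succ_of_notMem (h : n ∉ Ω) :
    π.withdrawn Ω (n + 1) = π.withdrawn Ω n := by
  rw [withdrawn, withdrawn, Finset.sum_range_succ]; simp only [h, if_false, add_zero]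

namespace Admissible

lemma charge_nonneg (hπ : π.Admissible) : 0 ≤ π.Δ * π.ηc * π.Pce :=
  mul_nonneg (mul_pos hπ.Δ_pos hπ.ηc_pos).le hπ.Pce_nonneg

lemma discharge_nonneg (hπ : π.Admissible) : 0 ≤ π.Δ * π.Pde / π.ηd :=
  div_nonneg (mul_nonneg hπ.Δ_pos.le hπ.Pde_nonneg) hπ.ηd_pos.le

lemma soc_mem_Icc (hπ : π.Admissible) (Ω : Finset ℕ) (n : ℕ) :
    π.soc Ω n ∈ Set.Icc π.Sl π.Su := by
  induction n with
  | zero => exact ⟨hπ.Sl_le, hπ.le_Su⟩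
  | succ n ih =>
    obtain ⟨h₁, h₂⟩ := ih
    have hc := hπ.charge_nonneg
    have hd := hπ.discharge_nonneg
    by_cases h : n ∈ Ω
    · rw [soc_succ_of_mem h]
      exact ⟨le_max_right _ _, max_le (by linarith) (by linarith)⟩
    · rw [soc_succ_of_notMem h]
      exact ⟨le_min (by linarith) (by linarith), min_le_right _ _⟩

/-- The greedy schedule withdraws at least as much as any feasible schedule, and so does its
stored energy together with what it has withdrawn. -/
lemma feas_le_withdrawn (hπ : π.Admissible) {tb : ℕ} {pd pc s : ℕ → ℝ}
    (h : π.Feas tb (Finset.range (tb + 1) \ Ω) pd pc s) (hn : n ≤ tb + 1) :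
    π.Δ / π.ηd * ∑ τ ∈ Finset.range n, pd τ ≤ π.withdrawn Ω n ∧
      π.Δ / π.ηd * ∑ τ ∈ Finset.range n, pd τ + s n ≤ π.withdrawn Ω n + π.soc Ω n := by
  induction n with
  | zero => simp [withdrawn, soc, h.1]
  | succ n ih =>
    obtain ⟨ih₁, ih₂⟩ := ih (by omega)
    obtain ⟨-, hpd, -, hpc, hl, hu, hs, hΩ, hΩ'⟩ := h.2 n (by omega)
    rw [Finset.sum_range_succ, mul_add]
    have hpd' : π.Δ / π.ηd * pd n ≤ π.Δ * π.Pde / π.ηd := by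
      rw [div_mul_eq_mul_div]
      have := hπ.Δ_pos
      have := hπ.ηd_pos
      gcongr
    have hpc' : π.Δ * π.ηc * pc n ≤ π.Δ * π.ηc * π.Pce :=
      mul_le_mul_of_nonneg_left hpc (mul_pos hπ.Δ_pos hπ.ηc_pos).le
    have hs' : s (n + 1) = s n + π.Δ * π.ηc * pc n - π.Δ / π.ηd * pd n := by
      rw [hs]; ring
    by_cases hm : n ∈ Ω
    · rw [hΩ' (by simp [hm])] at hs'
      rw [withdrawn_succ_of_mem hm, soc_succ_of_mem hm]
      rcases max_cases (π.soc Ω n - π.Δ * π.Pde / π.ηd) π.Sl with ⟨e, -⟩ | ⟨e, -⟩ <;>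
        rw [e] <;> constructor <;> linarith
    · have hz : pd n = 0 := hΩ (Finset.mem_sdiff.2 ⟨Finset.mem_range.2 (by omega), hm⟩)
      rw [hz] at hs' ⊢
      rw [withdrawn_succ_of_notMem hm, soc_succ_of_notMem hm]
      rcases min_cases (π.soc Ω n + π.Δ * π.ηc * π.Pce) π.Su with ⟨e, -⟩ | ⟨e, -⟩ <;>
        rw [e] <;> constructor <;> linarith

lemma feas_greedy (hπ : π.Admissible) (tb : ℕ) (Ω : Finset ℕ) :
    π.Feas tb (Finset.range (tb + 1) \ Ω)
      (fun τ => π.ηd / π.Δ * if τ ∈ Ω then π.soc Ω τ - π.soc Ω (τ + 1) else 0)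
      (fun τ => if τ ∈ Ω then 0 else (π.soc Ω (τ + 1) - π.soc Ω τ) / (π.Δ * π.ηc))
      (π.soc Ω) := by
  refine ⟨rfl, fun τ hτ => ?_⟩
  have hΔ := hπ.Δ_pos
  have hηc := hπ.ηc_pos
  have hηd := hπ.ηd_pos
  have hc := hπ.charge_nonneg
  have hd := hπ.discharge_nonneg
  obtain ⟨hl, hu⟩ := hπ.soc_mem_Icc Ω τ
  obtain ⟨hl', hu'⟩ := hπ.soc_mem_Icc Ω (τ + 1)
  have hr : τ ∈ Finset.range (tb + 1) := Finset.mem_range.2 (by omega)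
  by_cases h : τ ∈ Ω
  · have hge : π.soc Ω τ - π.Δ * π.Pde / π.ηd ≤ π.soc Ω (τ + 1) := by
      rw [soc_succ_of_mem h]; exact le_max_left _ _
    have hle : π.soc Ω (τ + 1) ≤ π.soc Ω τ := by
      rw [soc_succ_of_mem h]; exact max_le (by linarith) hl
    simp only [h, if_true]
    refine ⟨mul_nonneg (div_pos hηd hΔ).le (by linarith), ?_, le_rfl, hπ.Pce_nonneg, hl', hu', ?_,
      by simp [h], fun _ => trivial⟩
    · calc π.ηd / π.Δ * (π.soc Ω τ - π.soc Ω (τ + 1))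
          ≤ π.ηd / π.Δ * (π.Δ * π.Pde / π.ηd) :=
            mul_le_mul_of_nonneg_left (by linarith) (div_pos hηd hΔ).le
        _ = π.Pde := by field_simp
    · field_simp
      ring
  · have hle : π.soc Ω (τ + 1) ≤ π.soc Ω τ + π.Δ * π.ηc * π.Pce := by
      rw [soc_succ_of_notMem h]; exact min_le_left _ _
    have hge : π.soc Ω τ ≤ π.soc Ω (τ + 1) := by
      rw [soc_succ_of_notMem h]; exact le_min (by linarith) hu
    simp only [h, if_false, mul_zero]
    refine ⟨le_rfl, hπ.Pde_nonneg, div_nonneg (by linarith) (mul_pos hΔ hηc).le, ?_, hl', hu', ?_,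
      fun _ => trivial, fun h' => absurd (Finset.mem_sdiff.2 ⟨hr, h⟩) h'⟩
    · rw [div_le_iff₀ (mul_pos hΔ hηc)]
      linarith
    · field_simp
      ring

lemma g_eq (hπ : π.Admissible) (tb : ℕ) (Ω : Finset ℕ) :
    π.g tb Ω = π.ηd / π.Δ * π.withdrawn Ω (tb + 1) := by
  refine IsGreatest.csSup_eq ⟨⟨_, _, _, hπ.feas_greedy tb Ω, ?_⟩, ?_⟩
  · rw [withdrawn, Finset.mul_sum]
  · rintro x ⟨pd, pc, s, h, rfl⟩
    have hΔ := hπ.Δ_pos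
    have hηd := hπ.ηd_pos
    calc ∑ τ ∈ Finset.range (tb + 1), pd τ
        = π.ηd / π.Δ * (π.Δ / π.ηd * ∑ τ ∈ Finset.range (tb + 1), pd τ) := by field_simp
      _ ≤ _ := mul_le_mul_of_nonneg_left (hπ.feas_le_withdrawn h le_rfl).1 (div_pos hηd hΔ).le

/-- The greedy trajectories of `A`, `A ∪ {j}`, `B`, `B ∪ {j}` compared period by period. The last
inequality bounds the loss of stored energy caused by `j` for `A` by that for `B` plus the
surplus in marginal withdrawals, which makes the nonnegativity of this surplus inductive. -/
lemma withdrawn_insert_invariant (hπ : π.Admissible) (hAB : A ⊆ B) {j : ℕ} (hj : j ∉ B) (n : ℕ) :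
    (n ≤ j → π.soc (insert j A) n = π.soc A n ∧ π.soc (insert j B) n = π.soc B n) ∧
    π.soc (insert j A) n ≤ π.soc A n ∧ π.soc (insert j B) n ≤ π.soc B n ∧
    π.soc (insert j B) n ≤ π.soc (insert j A) n ∧
    π.withdrawn (insert j B) n - π.withdrawn B n ≤
      π.withdrawn (insert j A) n - π.withdrawn A n ∧
    π.soc A n - π.soc (insert j A) n ≤ π.soc B n - π.soc (insert j B) n +
      ((π.withdrawn (insert j A) n - π.withdrawn A n) -
        (π.withdrawn (insert j B) n - π.withdrawn B n)) := by
  induction n with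
  | zero => simp [withdrawn, soc]
  | succ n ih =>
    obtain ⟨h₀, h₁, h₂, h₃, h₄, h₅⟩ := ih
    have hc := hπ.charge_nonneg
    have hd := hπ.discharge_nonneg
    obtain ⟨la, ua⟩ := hπ.soc_mem_Icc A n
    obtain ⟨la', ua'⟩ := hπ.soc_mem_Icc (insert j A) n
    obtain ⟨lb, ub⟩ := hπ.soc_mem_Icc B n
    obtain ⟨lb', ub'⟩ := hπ.soc_mem_Icc (insert j B) n
    by_cases hnj : n = j
    · subst hnj
      have hA : n ∉ A := fun h => hj (hAB h)
      obtain ⟨ea, eb⟩ := h₀ le_rfl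
      refine ⟨fun h => absurd h (by omega), ?_⟩
      rw [withdrawn_succ_of_mem (Finset.mem_insert_self n A),
        withdrawn_succ_of_mem (Finset.mem_insert_self n B), withdrawn_succ_of_notMem hA,
        withdrawn_succ_of_notMem hj, soc_succ_of_mem (Finset.mem_insert_self n A),
        soc_succ_of_mem (Finset.mem_insert_self n B), soc_succ_of_notMem hA,
        soc_succ_of_notMem hj]
      rw [ea] at *
      rw [eb] at *
      grind
    · have hiA : n ∈ insert j A ↔ n ∈ A := by simp [hnj]
      have hiB : n ∈ insert j B ↔ n ∈ B := by simp [hnj]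
      refine ⟨fun h => ?_, ?_⟩
      · obtain ⟨ea, eb⟩ := h₀ (by omega)
        simp only [soc, hiA, hiB, ea, eb, and_self]
      clear h₀
      by_cases hnB : n ∈ B
      · by_cases hnA : n ∈ A
        · rw [withdrawn_succ_of_mem (hiA.2 hnA), withdrawn_succ_of_mem (hiB.2 hnB),
            withdrawn_succ_of_mem hnA, withdrawn_succ_of_mem hnB, soc_succ_of_mem (hiA.2 hnA),
            soc_succ_of_mem (hiB.2 hnB), soc_succ_of_mem hnA, soc_succ_of_mem hnB]
          grind
        · rw [withdrawn_succ_of_notMem (hiA.not.2 hnA), withdrawn_succ_of_mem (hiB.2 hnB),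
            withdrawn_succ_of_notMem hnA, withdrawn_succ_of_mem hnB,
            soc_succ_of_notMem (hiA.not.2 hnA),
            soc_succ_of_mem (hiB.2 hnB), soc_succ_of_notMem hnA, soc_succ_of_mem hnB]
          grind
      · have hnA : n ∉ A := fun h => hnB (hAB h)
        rw [withdrawn_succ_of_notMem (hiA.not.2 hnA), withdrawn_succ_of_notMem (hiB.not.2 hnB),
          withdrawn_succ_of_notMem hnA, withdrawn_succ_of_notMem hnB,
          soc_succ_of_notMem (hiA.not.2 hnA), soc_succ_of_notMem (hiB.not.2 hnB),
          soc_succ_of_notMem hnA, soc_succ_of_notMem hnB]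
        grind

end Admissible

end BatParams

/-- The set function `g` is submodular. -/
theorem g_submodular (π : BatParams) (tb : ℕ)
    (hΔ : 0 < π.Δ) (hηc : 0 < π.ηc) (hηc1 : π.ηc ≤ 1)
    (hηd : 0 < π.ηd) (hηd1 : π.ηd ≤ 1) (hS : π.Sl < π.Su)
    (hPc : 0 ≤ π.Pce) (hPd : 0 ≤ π.Pde)
    (hs1 : π.Sl ≤ π.sstar) (hs2 : π.sstar ≤ π.Su)
    (A B : Finset ℕ) (hAB : A ⊆ B) (hB : B ⊆ Finset.range (tb + 1))
    (j : ℕ) (hjT : j ∈ Finset.range (tb + 1)) (hjB : j ∉ B) :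
    π.g tb (insert j A) - π.g tb A ≥ π.g tb (insert j B) - π.g tb B := by
  have hπ : π.Admissible := ⟨hΔ, hηc, hηd, hPc, hPd, hs1, hs2⟩
  simp only [hπ.g_eq, ge_iff_le, ← mul_sub]
  exact mul_le_mul_of_nonneg_left (hπ.withdrawn_insert_invariant hAB hjB (tb + 1)).2.2.2.2.1
    (div_pos hηd hΔ).le
end

section
/- For every (p^d, p^c, s) ∈ 𝒫, every t ∈ {1,…,T}, and every τ̄ ∈ {0,…,T−t}, the charging valid inequality holds: Σ_{τ=0}^{τ̄} ( p^c_{t+τ} + ρ̄^c(t,τ,τ̄) · p^d_{t+τ} ) ≤ Σ_{τ=0}^{τ̄} c(t,τ). -/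
/-- Parameters of the energy storage system. -/
structure BatteryParams where
  Δ : ℝ
  ηc : ℝ
  ηd : ℝ
  Sl : ℝ
  Su : ℝ
  Pd : ℝ
  Pc : ℝ
  s0 : ℝ

namespace BatteryParams

/-- Effective maximum discharge rate. -/
noncomputable def Pde (π : BatteryParams) : ℝ := min π.Pd (π.ηd * (π.Su - π.Sl) / π.Δ)

/-- Effective maximum charge rate. -/
noncomputable def Pce (π : BatteryParams) : ℝ := min π.Pc ((π.Su - π.Sl) / (π.Δ * π.ηc))

/-- Lower state-of-charge envelope. -/
noncomputable def slo (π : BatteryParams) : ℕ → ℝ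
  | 0 => π.s0
  | t + 1 => max (π.slo t - (π.Δ / π.ηd) * π.Pde) π.Sl

/-- Upper state-of-charge envelope. -/
noncomputable def shi (π : BatteryParams) : ℕ → ℝ
  | 0 => π.s0
  | t + 1 => min (π.shi t + π.Δ * π.ηc * π.Pce) π.Su

/-- Coefficient `c(t, τ)`. -/
noncomputable def c (π : BatteryParams) (t τ : ℕ) : ℝ :=
  min π.Pce (max ((π.Su - π.slo (t - 1)) / (π.Δ * π.ηc) - (τ : ℝ) * π.Pce) 0)

/-- Coefficient `d(t, τ)`. -/
noncomputable def d (π : BatteryParams) (t τ : ℕ) : ℝ :=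
  min π.Pde (max ((π.shi (t - 1) - π.Sl) * π.ηd / π.Δ - (τ : ℝ) * π.Pde) 0)

/-- Coefficient `c̄(τ)`. -/
noncomputable def cbar (π : BatteryParams) (τ : ℕ) : ℝ :=
  min π.Pce (max ((π.Su - π.Sl) / (π.Δ * π.ηc) - (τ : ℝ) * π.Pce) 0)

/-- Coefficient `d̄(τ)`. -/
noncomputable def dbar (π : BatteryParams) (τ : ℕ) : ℝ :=
  min π.Pde (max ((π.Su - π.Sl) * π.ηd / π.Δ - (τ : ℝ) * π.Pde) 0)

/-- Time-dependent effective charge rate `P̄^c_e(t) = c(t,0)`. -/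
noncomputable def Pcet (π : BatteryParams) (t : ℕ) : ℝ := π.c t 0

/-- Time-dependent effective discharge rate `P̄^d_e(t) = d(t,0)`. -/
noncomputable def Pdet (π : BatteryParams) (t : ℕ) : ℝ := π.d t 0

/-- Coefficient `ρ^c(t, τ, τ̄)` (the sum `Σ_{j=0}^{τ̄-τ-1}` is over `range (τ̄ - τ)`). -/
noncomputable def ρc (π : BatteryParams) (t τ tb : ℕ) : ℝ :=
  max (-(π.Pdet (t + τ)) / (π.ηd * π.ηc))
    ((∑ j ∈ Finset.Icc τ tb, π.c t j) - ∑ j ∈ Finset.range (tb - τ), π.cbar j)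

/-- Coefficient `ρ^d(t, τ, τ̄)`. -/
noncomputable def ρd (π : BatteryParams) (t τ tb : ℕ) : ℝ :=
  max (-(π.ηd * π.ηc * π.Pcet (t + τ)))
    ((∑ j ∈ Finset.Icc τ tb, π.d t j) - ∑ j ∈ Finset.range (tb - τ), π.dbar j)

/-- Coefficient `ρ̄^c(t, τ, τ̄)` (in Lean, `x / 0 = 0`). -/
noncomputable def ρbarc (π : BatteryParams) (t τ tb : ℕ) : ℝ :=
  if π.ρc t τ tb ≤ 0 then -(1 / (π.ηd * π.ηc)) else π.ρc t τ tb / π.Pdet (t + τ)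

/-- Coefficient `ρ̄^d(t, τ, τ̄)` (in Lean, `x / 0 = 0`). -/
noncomputable def ρbard (π : BatteryParams) (t τ tb : ℕ) : ℝ :=
  if π.ρd t τ tb ≤ 0 then -(π.ηd * π.ηc) else π.ρd t τ tb / π.Pcet (t + τ)

/-- The nonconvex storage feasible set `𝒫` (with `s 0` the initial state of charge). -/
def Feasible (π : BatteryParams) (T : ℕ) (pd pc s : ℕ → ℝ) : Prop :=
  s 0 = π.s0 ∧ ∀ t, 1 ≤ t → t ≤ T →
    0 ≤ pd t ∧ pd t ≤ π.Pd ∧ 0 ≤ pc t ∧ pc t ≤ π.Pc ∧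
    π.Sl ≤ s t ∧ s t ≤ π.Su ∧
    s t = s (t - 1) + π.Δ * (π.ηc * pc t - pd t / π.ηd) ∧
    pd t * pc t = 0

end BatteryParams

/-- Greedy filling: increments capped by `C`, taken until the budget `A` is exhausted. -/
theorem sum_range_min_max_sub {C A : ℝ} (hC : 0 ≤ C) (hA : 0 ≤ A) (n : ℕ) :
    ∑ j ∈ Finset.range n, min C (max (A - (j : ℝ) * C) 0) = min (n * C) A := by
  induction n with
  | zero => simp [hA]
  | succ n ih =>
    rw [Finset.sum_range_succ, ih]
    push_cast
    rw [add_mul, one_mul]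
    generalize (n : ℝ) * C = x
    grind

namespace BatteryParams

variable {π : BatteryParams}

theorem Pde_nonneg (hΔ : 0 < π.Δ) (hηd : 0 < π.ηd) (hS : π.Sl ≤ π.Su) (hPd : 0 ≤ π.Pd) :
    0 ≤ π.Pde :=
  le_min hPd (div_nonneg (mul_nonneg hηd.le (sub_nonneg.2 hS)) hΔ.le)

theorem Pce_nonneg (hΔ : 0 < π.Δ) (hηc : 0 < π.ηc) (hS : π.Sl ≤ π.Su) (hPc : 0 ≤ π.Pc) :
    0 ≤ π.Pce :=
  le_min hPc (div_nonneg (sub_nonneg.2 hS) (mul_pos hΔ hηc).le)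

theorem Sl_le_slo (hs1 : π.Sl ≤ π.s0) : ∀ n, π.Sl ≤ π.slo n
  | 0 => hs1
  | _ + 1 => le_max_right _ _

theorem slo_le_Su (hΔ : 0 < π.Δ) (hηd : 0 < π.ηd) (hS : π.Sl ≤ π.Su) (hPd : 0 ≤ π.Pd)
    (hs2 : π.s0 ≤ π.Su) : ∀ n, π.slo n ≤ π.Su
  | 0 => hs2
  | n + 1 => max_le ((sub_le_self _ (mul_nonneg (div_pos hΔ hηd).le
      (Pde_nonneg hΔ hηd hS hPd))).trans (slo_le_Su hΔ hηd hS hPd hs2 n)) hS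

/-- The tail sum in `ρc` exceeds zero only through the last increment `c t tb`. -/
theorem sum_c_sub_sum_cbar (hC : 0 ≤ π.Pce) {t τ tb : ℕ} (hτ : τ ≤ tb)
    (hA : 0 ≤ (π.Su - π.slo (t - 1)) / (π.Δ * π.ηc))
    (hAW : (π.Su - π.slo (t - 1)) / (π.Δ * π.ηc) ≤ (π.Su - π.Sl) / (π.Δ * π.ηc)) :
    (0 < π.c t tb →
      (∑ j ∈ Finset.Icc τ tb, π.c t j) - ∑ j ∈ Finset.range (tb - τ), π.cbar j = π.c t tb) ∧
    (π.c t tb ≤ 0 →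
      (∑ j ∈ Finset.Icc τ tb, π.c t j) - ∑ j ∈ Finset.range (tb - τ), π.cbar j ≤ 0) := by
  have hIcc : ∑ j ∈ Finset.Icc τ tb, π.c t j =
      ∑ j ∈ Finset.range (tb + 1), π.c t j - ∑ j ∈ Finset.range τ, π.c t j := by
    rw [← Finset.sum_Ico_eq_sub _ (by omega : τ ≤ tb + 1)]
    rfl
  rw [hIcc]
  simp only [c, cbar]
  rw [sum_range_min_max_sub hC hA, sum_range_min_max_sub hC hA,
    sum_range_min_max_sub hC (hA.trans hAW)]
  have hx : (0 : ℝ) ≤ τ * π.Pce := by positivity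
  have hy : (0 : ℝ) ≤ ((tb - τ : ℕ) : ℝ) * π.Pce := by positivity
  have hxy : (tb : ℝ) * π.Pce = τ * π.Pce + ((tb - τ : ℕ) : ℝ) * π.Pce := by
    rw [Nat.cast_sub hτ]; ring
  have hzero : π.Pce ≤ 0 → (τ : ℝ) * π.Pce = 0 ∧ ((tb - τ : ℕ) : ℝ) * π.Pce = 0 := by
    intro h
    have : π.Pce = 0 := le_antisymm h hC
    simp [this]
  push_cast [add_mul, one_mul]
  rw [hxy]
  generalize (τ : ℝ) * π.Pce = x at *
  generalize ((tb - τ : ℕ) : ℝ) * π.Pce = y at *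
  generalize (π.Su - π.slo (t - 1)) / (π.Δ * π.ηc) = A at *
  generalize (π.Su - π.Sl) / (π.Δ * π.ηc) = W at *
  generalize π.Pce = C at *
  constructor <;> intro h <;> grind

namespace Feasible

variable {T : ℕ} {pd pc s : ℕ → ℝ}

theorem bounds (h : π.Feasible T pd pc s) (hs1 : π.Sl ≤ π.s0) (hs2 : π.s0 ≤ π.Su)
    {n : ℕ} (hn : n ≤ T) : π.Sl ≤ s n ∧ s n ≤ π.Su := by
  rcases Nat.eq_zero_or_pos n with rfl | hpos
  · rw [h.1]; exact ⟨hs1, hs2⟩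
  · obtain ⟨-, -, -, -, h1, h2, -⟩ := h.2 n hpos hn
    exact ⟨h1, h2⟩

theorem pc_eq_zero_or_pd_eq_zero (h : π.Feasible T pd pc s) {n : ℕ} (hn : n + 1 ≤ T) :
    pc (n + 1) = 0 ∨ pd (n + 1) = 0 := by
  obtain ⟨-, -, -, -, -, -, -, h0⟩ := h.2 (n + 1) (by omega) hn
  exact (mul_eq_zero.1 h0).symm

theorem step (h : π.Feasible T pd pc s) {n : ℕ} (hn : n + 1 ≤ T) :
    s (n + 1) = s n + π.Δ * (π.ηc * pc (n + 1) - pd (n + 1) / π.ηd) := by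
  obtain ⟨-, -, -, -, -, -, h0, -⟩ := h.2 (n + 1) (by omega) hn
  simpa using h0

theorem pd_le_Pde (h : π.Feasible T pd pc s) (hΔ : 0 < π.Δ) (hηd : 0 < π.ηd)
    (hS : π.Sl ≤ π.Su) (hs1 : π.Sl ≤ π.s0) (hs2 : π.s0 ≤ π.Su) {n : ℕ} (hn : n + 1 ≤ T) :
    pd (n + 1) ≤ π.Pde := by
  obtain ⟨-, h1, -⟩ := h.2 (n + 1) (by omega) hn
  refine le_min h1 ?_
  rcases h.pc_eq_zero_or_pd_eq_zero hn with h0 | h0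
  · have hstep := h.step hn
    have hb := h.bounds hs1 hs2 hn
    have hb' := h.bounds hs1 hs2 (n := n) (by omega)
    rw [h0] at hstep
    have : pd (n + 1) = (s n - s (n + 1)) * π.ηd / π.Δ := by
      rw [hstep]; field_simp; ring
    rw [this, mul_comm π.ηd]
    gcongr <;> linarith
  · rw [h0]
    exact div_nonneg (mul_nonneg hηd.le (sub_nonneg.2 hS)) hΔ.le

theorem pc_le_Pce (h : π.Feasible T pd pc s) (hΔ : 0 < π.Δ) (hηc : 0 < π.ηc)
    (hS : π.Sl ≤ π.Su) (hs1 : π.Sl ≤ π.s0) (hs2 : π.s0 ≤ π.Su) {n : ℕ} (hn : n + 1 ≤ T) :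
    pc (n + 1) ≤ π.Pce := by
  obtain ⟨-, -, -, h1, -⟩ := h.2 (n + 1) (by omega) hn
  refine le_min h1 ?_
  rcases h.pc_eq_zero_or_pd_eq_zero hn with h0 | h0
  · rw [h0]
    exact div_nonneg (sub_nonneg.2 hS) (mul_pos hΔ hηc).le
  · have hstep := h.step hn
    have hb := h.bounds hs1 hs2 hn
    have hb' := h.bounds hs1 hs2 (n := n) (by omega)
    rw [h0, zero_div, sub_zero] at hstep
    rw [le_div_iff₀ (mul_pos hΔ hηc)]
    linarith

theorem slo_le (h : π.Feasible T pd pc s) (hΔ : 0 < π.Δ) (hηc : 0 < π.ηc) (hηd : 0 < π.ηd)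
    (hS : π.Sl ≤ π.Su) (hs1 : π.Sl ≤ π.s0) (hs2 : π.s0 ≤ π.Su) :
    ∀ {n : ℕ}, n ≤ T → π.slo n ≤ s n
  | 0, _ => h.1.ge
  | n + 1, hn => by
    have ih := slo_le h hΔ hηc hηd hS hs1 hs2 (n := n) (by omega)
    refine max_le ?_ (h.bounds hs1 hs2 hn).1
    have hpd := mul_le_mul_of_nonneg_left (h.pd_le_Pde hΔ hηd hS hs1 hs2 hn) (div_pos hΔ hηd).le
    obtain ⟨-, -, h2, -⟩ := h.2 (n + 1) (by omega) hn
    have hpc : 0 ≤ π.Δ * (π.ηc * pc (n + 1)) := by positivity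
    have hstep : s (n + 1) =
        s n + π.Δ * (π.ηc * pc (n + 1)) - π.Δ / π.ηd * pd (n + 1) := by
      rw [h.step hn]; ring
    linarith

theorem le_shi (h : π.Feasible T pd pc s) (hΔ : 0 < π.Δ) (hηc : 0 < π.ηc) (hηd : 0 < π.ηd)
    (hS : π.Sl ≤ π.Su) (hs1 : π.Sl ≤ π.s0) (hs2 : π.s0 ≤ π.Su) :
    ∀ {n : ℕ}, n ≤ T → s n ≤ π.shi n
  | 0, _ => h.1.le
  | n + 1, hn => by
    have ih := le_shi h hΔ hηc hηd hS hs1 hs2 (n := n) (by omega)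
    refine le_min ?_ (h.bounds hs1 hs2 hn).2
    have hpc := mul_le_mul_of_nonneg_left (h.pc_le_Pce hΔ hηc hS hs1 hs2 hn)
      (mul_pos hΔ hηc).le
    obtain ⟨h1, -⟩ := h.2 (n + 1) (by omega) hn
    have hpd : 0 ≤ π.Δ * (pd (n + 1) / π.ηd) := by positivity
    have hstep : s (n + 1) =
        s n + π.Δ * π.ηc * pc (n + 1) - π.Δ * (pd (n + 1) / π.ηd) := by
      rw [h.step hn]; ring
    linarith

theorem pd_le_Pdet (h : π.Feasible T pd pc s) (hΔ : 0 < π.Δ) (hηc : 0 < π.ηc)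
    (hηd : 0 < π.ηd) (hS : π.Sl ≤ π.Su) (hs1 : π.Sl ≤ π.s0)
    (hs2 : π.s0 ≤ π.Su) {n : ℕ} (hn : n + 1 ≤ T) : pd (n + 1) ≤ π.Pdet (n + 1) := by
  simp only [Pdet, d, Nat.cast_zero, zero_mul, sub_zero, Nat.add_sub_cancel]
  refine le_min (h.pd_le_Pde hΔ hηd hS hs1 hs2 hn) ?_
  rcases h.pc_eq_zero_or_pd_eq_zero hn with h0 | h0
  · refine le_max_of_le_left ?_
    have hstep := h.step hn
    have hb := h.bounds hs1 hs2 hn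
    have hshi := h.le_shi hΔ hηc hηd hS hs1 hs2 (n := n) (by omega)
    rw [h0] at hstep
    have : pd (n + 1) = (s n - s (n + 1)) * π.ηd / π.Δ := by
      rw [hstep]; field_simp; ring
    rw [this]
    gcongr
    exact hb.1
  · rw [h0]
    exact le_max_right _ _

/-- Total net charge over a window, measured on the charging side. -/
theorem sum_net_charge (h : π.Feasible T pd pc s) (hΔ : 0 < π.Δ) (hηc : 0 < π.ηc)
    (hηd : 0 < π.ηd) (m n : ℕ) (hn : m + n ≤ T) :
    ∑ τ ∈ Finset.range n, (pc (m + 1 + τ) + -(1 / (π.ηd * π.ηc)) * pd (m + 1 + τ)) =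
      (s (m + n) - s m) / (π.Δ * π.ηc) := by
  induction n with
  | zero => simp
  | succ n ih =>
    have hstep := h.step (n := m + n) (by omega)
    rw [Finset.sum_range_succ, ih (by omega), show m + 1 + n = m + n + 1 by omega,
      show m + (n + 1) = m + n + 1 by omega, hstep]
    field_simp
    ring

end Feasible

end BatteryParams

/-- Theorem 1 (charging part): the inequalities (11) are valid for `𝒫`. -/
theorem charging_valid_inequality (π : BatteryParams) (T : ℕ) (hT : 1 ≤ T)
    (hΔ : 0 < π.Δ) (hηc : 0 < π.ηc) (hηc1 : π.ηc ≤ 1)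
    (hηd : 0 < π.ηd) (hηd1 : π.ηd ≤ 1)
    (hSl : 0 ≤ π.Sl) (hS : π.Sl < π.Su)
    (hPd : 0 ≤ π.Pd) (hPc : 0 ≤ π.Pc)
    (hs1 : π.Sl ≤ π.s0) (hs2 : π.s0 ≤ π.Su)
    (pd pc s : ℕ → ℝ) (hfeas : π.Feasible T pd pc s)
    (t : ℕ) (ht1 : 1 ≤ t) (htT : t ≤ T)
    (tb : ℕ) (htb : tb ≤ T - t) :
    ∑ τ ∈ Finset.range (tb + 1), (pc (t + τ) + π.ρbarc t τ tb * pd (t + τ)) ≤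
      ∑ τ ∈ Finset.range (tb + 1), π.c t τ := by
  obtain ⟨m, rfl⟩ : ∃ m, t = m + 1 := ⟨t - 1, by omega⟩
  have hS' := hS.le
  have hC := BatteryParams.Pce_nonneg hΔ hηc hS' hPc
  have hK : 0 < π.Δ * π.ηc := mul_pos hΔ hηc
  have hκ : 0 < π.ηd * π.ηc := mul_pos hηd hηc
  have hA : 0 ≤ (π.Su - π.slo (m + 1 - 1)) / (π.Δ * π.ηc) :=
    div_nonneg (sub_nonneg.2 (BatteryParams.slo_le_Su hΔ hηd hS' hPd hs2 _)) hK.le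
  have hAW : (π.Su - π.slo (m + 1 - 1)) / (π.Δ * π.ηc) ≤ (π.Su - π.Sl) / (π.Δ * π.ηc) := by
    have := BatteryParams.Sl_le_slo hs1 (m + 1 - 1)
    gcongr
  have hpd0 : ∀ τ ∈ Finset.range (tb + 1), 0 ≤ pd (m + 1 + τ) := by
    intro τ hτ
    rw [Finset.mem_range] at hτ
    exact (hfeas.2 _ (by omega) (by omega)).1
  have hpc : ∀ τ ∈ Finset.range (tb + 1), pc (m + 1 + τ) ≤ π.Pce := by
    intro τ hτ
    rw [Finset.mem_range] at hτ
    rw [show m + 1 + τ = m + τ + 1 by omega]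
    exact hfeas.pc_le_Pce hΔ hηc hS' hs1 hs2 (by omega)
  have hpdet : ∀ τ ∈ Finset.range (tb + 1), pd (m + 1 + τ) ≤ π.Pdet (m + 1 + τ) := by
    intro τ hτ
    rw [Finset.mem_range] at hτ
    rw [show m + 1 + τ = m + τ + 1 by omega]
    exact hfeas.pd_le_Pdet hΔ hηc hηd hS' hs1 hs2 (by omega)
  have hρneg : ∀ τ ∈ Finset.range (tb + 1),
      -(π.Pdet (m + 1 + τ)) / (π.ηd * π.ηc) ≤ 0 := fun τ hτ =>
    div_nonpos_of_nonpos_of_nonneg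
      (neg_nonpos.2 ((hpd0 τ hτ).trans (hpdet τ hτ))) hκ.le
  have hnet : ∑ τ ∈ Finset.range (tb + 1),
      (pc (m + 1 + τ) + -(1 / (π.ηd * π.ηc)) * pd (m + 1 + τ)) ≤
        ∑ τ ∈ Finset.range (tb + 1), π.c (m + 1) τ := by
    simp only [BatteryParams.c]
    rw [sum_range_min_max_sub hC hA]
    refine le_min ?_ ?_
    · calc _ ≤ ∑ τ ∈ Finset.range (tb + 1), π.Pce := by
            refine Finset.sum_le_sum fun τ hτ => ?_
            have h1 : 0 ≤ 1 / (π.ηd * π.ηc) * pd (m + 1 + τ) :=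
              mul_nonneg (by positivity) (hpd0 τ hτ)
            linarith [hpc τ hτ]
        _ = _ := by simp
    · rw [hfeas.sum_net_charge hΔ hηc hηd m (tb + 1) (by omega)]
      have h1 := (hfeas.bounds hs1 hs2 (n := m + (tb + 1)) (by omega)).2
      have h2 := hfeas.slo_le hΔ hηc hηd hS' hs1 hs2 (n := m) (by omega)
      rw [Nat.add_sub_cancel]
      gcongr
  rcases le_or_gt (π.c (m + 1) tb) 0 with hr | hr
  · refine le_of_eq_of_le (Finset.sum_congr rfl fun τ hτ => ?_) hnet
    have hle : π.ρc (m + 1) τ tb ≤ 0 := max_le (hρneg τ hτ)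
      ((BatteryParams.sum_c_sub_sum_cbar hC
        (Nat.lt_succ_iff.1 (Finset.mem_range.1 hτ)) hA hAW).2 hr)
    rw [BatteryParams.ρbarc, if_pos hle]
  · have hρ : ∀ τ ∈ Finset.range (tb + 1),
        π.ρbarc (m + 1) τ tb = π.c (m + 1) tb / π.Pdet (m + 1 + τ) := by
      intro τ hτ
      have heq : π.ρc (m + 1) τ tb = π.c (m + 1) tb := by
        rw [BatteryParams.ρc, (BatteryParams.sum_c_sub_sum_cbar hC
          (Nat.lt_succ_iff.1 (Finset.mem_range.1 hτ)) hA hAW).1 hr]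
        exact max_eq_right ((hρneg τ hτ).trans hr.le)
      rw [BatteryParams.ρbarc, heq, if_neg hr.not_ge]
    have hcC : π.c (m + 1) tb ≤ π.Pce := min_le_left _ _
    by_cases hex : ∃ τ₀ ∈ Finset.range (tb + 1), pd (m + 1 + τ₀) ≠ 0
    · obtain ⟨τ₀, hτ₀, hne⟩ := hex
      have hdis : ∀ τ ∈ Finset.range (tb + 1), pd (m + 1 + τ) ≠ 0 →
          pc (m + 1 + τ) + π.ρbarc (m + 1) τ tb * pd (m + 1 + τ) ≤ π.c (m + 1) tb := by
        intro τ hτ hne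
        have hlt := Finset.mem_range.1 hτ
        have hpc0 : pc (m + 1 + τ) = 0 := by
          rw [show m + 1 + τ = m + τ + 1 by omega] at hne ⊢
          exact (hfeas.pc_eq_zero_or_pd_eq_zero (by omega)).resolve_right hne
        rw [hρ τ hτ, hpc0, zero_add, div_mul_eq_mul_div, mul_div_assoc]
        exact mul_le_of_le_one_right hr.le
          (div_le_one_of_le₀ (hpdet τ hτ) ((hpd0 τ hτ).trans (hpdet τ hτ)))
      have hall : ∀ τ ∈ Finset.range (tb + 1),
          pc (m + 1 + τ) + π.ρbarc (m + 1) τ tb * pd (m + 1 + τ) ≤ π.Pce := by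
        intro τ hτ
        by_cases h0 : pd (m + 1 + τ) = 0
        · simpa [h0] using hpc τ hτ
        · exact (hdis τ hτ h0).trans hcC
      have hfull : ∀ τ ∈ Finset.range tb, π.c (m + 1) τ = π.Pce := by
        intro τ hτ
        have hle : ((τ : ℝ) + 1) * π.Pce ≤ tb * π.Pce := by
          have : (τ : ℝ) + 1 ≤ tb := by exact_mod_cast Finset.mem_range.1 hτ
          gcongr
        rw [BatteryParams.c, lt_min_iff, lt_max_iff] at hr
        have hlt := hr.2.resolve_right (lt_irrefl 0)
        exact min_eq_left (le_max_of_le_left (by linarith))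
      rw [Finset.sum_range_succ (fun τ => π.c (m + 1) τ), Finset.sum_congr rfl hfull,
        ← Finset.add_sum_erase _ _ hτ₀, add_comm]
      refine add_le_add ?_ (hdis τ₀ hτ₀ hne)
      refine (Finset.sum_le_card_nsmul _ _ π.Pce
        fun τ hτ => hall τ (Finset.mem_of_mem_erase hτ)).trans_eq ?_
      rw [Finset.card_erase_of_mem hτ₀]
      simp
    · push Not at hex
      refine le_of_eq_of_le (Finset.sum_congr rfl fun τ hτ => ?_) hnet
      rw [hex τ hτ, mul_zero, mul_zero]
end

section
/- For every (p^d, p^c, s, u) ∈ 𝒫^{0-1}, every t ∈ {1,…,T}, and every τ̄ ∈ {0,…,T−t}, it holds that Σ_{τ=0}^{τ̄} p^d_{t+τ} + Σ_{τ=0}^{τ̄} ρ^d(t,τ,τ̄) u_{t+τ} ≤ Σ_{τ=0}^{τ̄} d(t,τ). -/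
/-- The mixed-integer storage feasible set `𝒫^{0-1}`. -/
def BatteryParams.FeasibleMI (π : BatteryParams) (T : ℕ)
    (pd pc s u : ℕ → ℝ) : Prop :=
  s 0 = π.s0 ∧ ∀ t, 1 ≤ t → t ≤ T →
    (u t = 0 ∨ u t = 1) ∧
    0 ≤ pd t ∧ pd t ≤ π.Pd * (1 - u t) ∧
    0 ≤ pc t ∧ pc t ≤ π.Pc * u t ∧
    π.Sl ≤ s t ∧ s t ≤ π.Su ∧
    s t = s (t - 1) + π.Δ * (π.ηc * pc t - pd t / π.ηd)

open Finset in
/-- If every step `k < n` of a quantity `v` is either bounded by both the rate `P` and the drop of a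
level `y ∈ [0, M]`, or bounded by `min (n P) H - min (k P) H - min ((n - 1 - k) P) M`, then the
total of `v` over `n` steps is at most `min (n P) H`, provided that the initial level is at most
`H ≤ M`. -/
theorem sum_range_le_min_of_level {n : ℕ} {P H M : ℝ} (hP : 0 ≤ P) (hHM : H ≤ M)
    {v y : ℕ → ℝ} (hy0 : ∀ k ≤ n, 0 ≤ y k) (hyM : ∀ k ≤ n, y k ≤ M) (hyH : y 0 ≤ H)
    (hv : ∀ k < n, (v k ≤ P ∧ v k ≤ y k - y (k + 1)) ∨
      v k ≤ min (n * P) H - min (k * P) H - min (((n - 1 - k : ℕ) : ℝ) * P) M) :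
    ∑ k ∈ range n, v k ≤ min (n * P) H := by
  have key : ∀ m k, k + m = n → ∃ σ, k ≤ σ ∧ σ ≤ n ∧
      ∑ i ∈ Ico k n, v i ≤
        min (((σ : ℝ) - k) * P) (y k) + min (n * P) H - min (σ * P) H := by
    intro m
    induction m with
    | zero =>
      intro k hk
      obtain rfl : k = n := by omega
      exact ⟨k, le_rfl, le_rfl, by simp [hy0 k le_rfl]⟩
    | succ m ih =>
      intro k hk
      have hkn : k < n := by omega
      obtain ⟨σ, hkσ, hσn, hσ⟩ := ih (k + 1) (by omega)
      rw [sum_eq_sum_Ico_succ_bot hkn]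
      push_cast at hσ
      rcases hv k hkn with ⟨h1, h2⟩ | h
      · refine ⟨σ, by omega, hσn, ?_⟩
        have : min (((σ : ℝ) - (k + 1)) * P) (y (k + 1)) + v k ≤
            min (((σ : ℝ) - k) * P) (y k) :=
          le_min (by nlinarith [min_le_left (((σ : ℝ) - (k + 1)) * P) (y (k + 1))])
            (by linarith [min_le_right (((σ : ℝ) - (k + 1)) * P) (y (k + 1))])
        linarith
      · refine ⟨k, le_rfl, hkn.le, ?_⟩
        have hcast : (((n - 1 - k : ℕ) : ℝ)) = n - 1 - k := by
          rw [Nat.cast_sub (by omega), Nat.cast_sub (by omega)]; simp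
        rw [hcast] at h
        have hyk := hyM (k + 1) hkn
        have hkσ' : (k : ℝ) + 1 ≤ σ := by exact_mod_cast hkσ
        have hσn' : (σ : ℝ) ≤ n := by exact_mod_cast hσn
        have hkP : 0 ≤ (k : ℝ) * P := by positivity
        have hσnP : (σ : ℝ) * P ≤ n * P := by gcongr
        have hE : min (((σ : ℝ) - (k + 1)) * P) (y (k + 1)) + min (n * P) H - min (σ * P) H ≤
            min (((n : ℝ) - 1 - k) * P) M := by
          have e1 := min_le_left (((σ : ℝ) - (k + 1)) * P) (y (k + 1))
          have e2 := min_le_right (((σ : ℝ) - (k + 1)) * P) (y (k + 1))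
          have e3 := min_le_left (n * P) H
          have e4 := min_le_right (n * P) H
          apply le_min <;> rcases min_cases ((σ : ℝ) * P) H with ⟨h, _⟩ | ⟨h, _⟩ <;>
            rw [h] <;> nlinarith
        have := hy0 k hkn.le
        simp only [sub_self, zero_mul, min_eq_left this]
        linarith
  obtain ⟨σ, -, -, hσ⟩ := key n 0 (by omega)
  rw [← Nat.Ico_zero_eq_range]
  have : min (((σ : ℝ) - (0 : ℕ)) * P) (y 0) ≤ min (σ * P) H := by
    simpa using min_le_min_left ((σ : ℝ) * P) hyH
  linarith

/-- A truncated rate is the increment of the truncated cumulative amount. -/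
theorem min_max_sub_mul_eq {P H : ℝ} (hP : 0 ≤ P) (hH : 0 ≤ H) (j : ℕ) :
    min P (max (H - j * P) 0) = min (((j + 1 : ℕ) : ℝ) * P) H - min (j * P) H := by
  have hj : 0 ≤ (j : ℝ) * P := by positivity
  push_cast
  rw [add_mul, one_mul]
  grind

namespace BatteryParams

theorem shi_le (π : BatteryParams) (h : π.s0 ≤ π.Su) (t : ℕ) : π.shi t ≤ π.Su := by
  cases t with
  | zero => exact h
  | succ t => exact min_le_right _ _

theorem sum_range_d (π : BatteryParams) {t : ℕ} (hP : 0 ≤ π.Pde)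
    (hH : 0 ≤ (π.shi (t - 1) - π.Sl) * π.ηd / π.Δ) (n : ℕ) :
    ∑ j ∈ Finset.range n, π.d t j = min (n * π.Pde) ((π.shi (t - 1) - π.Sl) * π.ηd / π.Δ) := by
  simp only [d, min_max_sub_mul_eq hP hH]
  rw [Finset.sum_range_sub (fun j : ℕ => min ((j : ℝ) * π.Pde) _)]
  simp [hH]

theorem sum_range_dbar (π : BatteryParams) (hP : 0 ≤ π.Pde)
    (hM : 0 ≤ (π.Su - π.Sl) * π.ηd / π.Δ) (n : ℕ) :
    ∑ j ∈ Finset.range n, π.dbar j = min (n * π.Pde) ((π.Su - π.Sl) * π.ηd / π.Δ) := by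
  simp only [dbar, min_max_sub_mul_eq hP hM]
  rw [Finset.sum_range_sub (fun j : ℕ => min ((j : ℝ) * π.Pde) _)]
  simp [hM]

namespace FeasibleMI

variable {π : BatteryParams} {T : ℕ} {pd pc s u : ℕ → ℝ}

theorem soc_mem (h : π.FeasibleMI T pd pc s u) (hs1 : π.Sl ≤ π.s0) (hs2 : π.s0 ≤ π.Su)
    {t : ℕ} (ht : t ≤ T) : π.Sl ≤ s t ∧ s t ≤ π.Su := by
  rcases Nat.eq_zero_or_pos t with rfl | h0
  · rw [h.1]; exact ⟨hs1, hs2⟩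
  · obtain ⟨-, -, -, -, -, h1, h2, -⟩ := h.2 t h0 ht
    exact ⟨h1, h2⟩

theorem discharge_or_charge (h : π.FeasibleMI T pd pc s u) {t : ℕ} (ht : t + 1 ≤ T) :
    (u (t + 1) = 0 ∧ pc (t + 1) = 0 ∧ 0 ≤ pd (t + 1) ∧ pd (t + 1) ≤ π.Pd ∧
      s (t + 1) = s t - π.Δ * (pd (t + 1) / π.ηd)) ∨
    (u (t + 1) = 1 ∧ pd (t + 1) = 0 ∧ 0 ≤ pc (t + 1) ∧ pc (t + 1) ≤ π.Pc ∧
      s (t + 1) = s t + π.Δ * π.ηc * pc (t + 1)) := by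
  obtain ⟨hu, h1, h2, h3, h4, -, -, h5⟩ := h.2 (t + 1) (by omega) ht
  rw [Nat.add_sub_cancel] at h5
  rcases hu with hu | hu <;> rw [hu] at h2 h4
  · have hc : pc (t + 1) = 0 := by linarith
    exact Or.inl ⟨hu, hc, h1, by linarith, by rw [h5, hc]; ring⟩
  · have hd : pd (t + 1) = 0 := by linarith
    exact Or.inr ⟨hu, hd, h3, by linarith, by rw [h5, hd]; ring⟩

theorem discharge_le_Pde (h : π.FeasibleMI T pd pc s u) (hΔ : 0 < π.Δ) (hηd : 0 < π.ηd)
    (hPd : 0 ≤ π.Pd) (hs1 : π.Sl ≤ π.s0) (hs2 : π.s0 ≤ π.Su) {t : ℕ} (ht : t + 1 ≤ T) :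
    pd (t + 1) ≤ π.Pde := by
  have ha := h.soc_mem hs1 hs2 (show t ≤ T by omega)
  have hb := h.soc_mem hs1 hs2 ht
  rcases h.discharge_or_charge ht with ⟨-, -, -, h1, h2⟩ | ⟨-, h1, -, -, -⟩
  · refine le_min h1 ?_
    rw [le_div_iff₀ hΔ]
    have : pd (t + 1) * π.Δ = π.ηd * (s t - s (t + 1)) := by rw [h2]; field_simp; ring
    rw [this]
    gcongr <;> linarith
  · rw [h1]
    have : 0 ≤ π.Su - π.Sl := by linarith
    exact le_min hPd (by positivity)

theorem charge_le_Pce (h : π.FeasibleMI T pd pc s u) (hΔ : 0 < π.Δ) (hηc : 0 < π.ηc)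
    (hPc : 0 ≤ π.Pc) (hs1 : π.Sl ≤ π.s0) (hs2 : π.s0 ≤ π.Su) {t : ℕ} (ht : t + 1 ≤ T) :
    pc (t + 1) ≤ π.Pce := by
  have ha := h.soc_mem hs1 hs2 (show t ≤ T by omega)
  have hb := h.soc_mem hs1 hs2 ht
  rcases h.discharge_or_charge ht with ⟨-, h1, -, -, -⟩ | ⟨-, -, -, h1, h2⟩
  · rw [h1]
    have : 0 ≤ π.Su - π.Sl := by linarith
    exact le_min hPc (by positivity)
  · refine le_min h1 ?_
    rw [le_div_iff₀ (by positivity)]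
    linarith

theorem slo_le (h : π.FeasibleMI T pd pc s u) (hΔ : 0 < π.Δ) (hηc : 0 < π.ηc) (hηd : 0 < π.ηd)
    (hPd : 0 ≤ π.Pd) (hs1 : π.Sl ≤ π.s0) (hs2 : π.s0 ≤ π.Su) {t : ℕ} (ht : t ≤ T) :
    π.slo t ≤ s t := by
  induction t with
  | zero => exact h.1.ge
  | succ t ih =>
    refine max_le ?_ (h.soc_mem hs1 hs2 ht).1
    have hp := h.discharge_le_Pde hΔ hηd hPd hs1 hs2 ht
    have ih := ih (by omega)
    have hd : π.Δ / π.ηd * pd (t + 1) ≤ π.Δ / π.ηd * π.Pde := by gcongr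
    rcases h.discharge_or_charge ht with ⟨-, -, -, -, h2⟩ | ⟨-, h1, h2, -, h3⟩
    · have : π.Δ * (pd (t + 1) / π.ηd) = π.Δ / π.ηd * pd (t + 1) := by ring
      linarith
    · rw [h1, mul_zero] at hd
      have : 0 ≤ π.Δ * π.ηc * pc (t + 1) := by positivity
      linarith

theorem le_shi (h : π.FeasibleMI T pd pc s u) (hΔ : 0 < π.Δ) (hηc : 0 < π.ηc) (hηd : 0 < π.ηd)
    (hPc : 0 ≤ π.Pc) (hs1 : π.Sl ≤ π.s0) (hs2 : π.s0 ≤ π.Su) {t : ℕ} (ht : t ≤ T) :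
    s t ≤ π.shi t := by
  induction t with
  | zero => exact h.1.le
  | succ t ih =>
    refine le_min ?_ (h.soc_mem hs1 hs2 ht).2
    have hp := h.charge_le_Pce hΔ hηc hPc hs1 hs2 ht
    have ih := ih (by omega)
    have hc : π.Δ * π.ηc * pc (t + 1) ≤ π.Δ * π.ηc * π.Pce := by gcongr
    rcases h.discharge_or_charge ht with ⟨-, h1, h2, -, h3⟩ | ⟨-, -, -, -, h3⟩
    · rw [h1, mul_zero] at hc
      have : 0 ≤ π.Δ * (pd (t + 1) / π.ηd) := by positivity
      linarith
    · linarith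

theorem charge_le_Pcet (h : π.FeasibleMI T pd pc s u) (hΔ : 0 < π.Δ) (hηc : 0 < π.ηc)
    (hηd : 0 < π.ηd) (hPd : 0 ≤ π.Pd) (hPc : 0 ≤ π.Pc) (hs1 : π.Sl ≤ π.s0) (hs2 : π.s0 ≤ π.Su)
    {t : ℕ} (ht : t + 1 ≤ T) : pc (t + 1) ≤ π.Pcet (t + 1) := by
  refine le_min (h.charge_le_Pce hΔ hηc hPc hs1 hs2 ht) ?_
  rcases h.discharge_or_charge ht with ⟨-, h1, -, -, -⟩ | ⟨-, -, -, -, h2⟩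
  · rw [h1]; exact le_max_right _ _
  · refine le_max_of_le_left ?_
    rw [Nat.cast_zero, zero_mul, sub_zero, Nat.add_sub_cancel, le_div_iff₀ (by positivity)]
    have := h.slo_le hΔ hηc hηd hPd hs1 hs2 (show t ≤ T by omega)
    have := (h.soc_mem hs1 hs2 ht).2
    linarith

end FeasibleMI

end BatteryParams


/-- The valid inequality (19) in terms of the binary variables `u`. -/
theorem discharging_valid_inequality_u (π : BatteryParams) (T : ℕ) (hT : 1 ≤ T)
    (hΔ : 0 < π.Δ) (hηc : 0 < π.ηc) (hηc1 : π.ηc ≤ 1)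
    (hηd : 0 < π.ηd) (hηd1 : π.ηd ≤ 1)
    (hSl : 0 ≤ π.Sl) (hS : π.Sl < π.Su)
    (hPd : 0 ≤ π.Pd) (hPc : 0 ≤ π.Pc)
    (hs1 : π.Sl ≤ π.s0) (hs2 : π.s0 ≤ π.Su)
    (pd pc s u : ℕ → ℝ) (hfeas : π.FeasibleMI T pd pc s u)
    (t : ℕ) (ht1 : 1 ≤ t) (htT : t ≤ T)
    (tb : ℕ) (htb : tb ≤ T - t) :
    (∑ τ ∈ Finset.range (tb + 1), pd (t + τ)) +
        (∑ τ ∈ Finset.range (tb + 1), π.ρd t τ tb * u (t + τ)) ≤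
      ∑ τ ∈ Finset.range (tb + 1), π.d t τ := by
  have hM : 0 ≤ (π.Su - π.Sl) * π.ηd / π.Δ := by
    have : 0 ≤ π.Su - π.Sl := by linarith
    positivity
  have hP : 0 ≤ π.Pde := le_min hPd (by rwa [mul_comm])
  have hshi := hfeas.le_shi hΔ hηc hηd hPc hs1 hs2 (show t - 1 ≤ T by omega)
  have hH : 0 ≤ (π.shi (t - 1) - π.Sl) * π.ηd / π.Δ := by
    have : 0 ≤ π.shi (t - 1) - π.Sl := by
      linarith [(hfeas.soc_mem hs1 hs2 (show t - 1 ≤ T by omega)).1]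
    positivity
  rw [← Finset.sum_add_distrib, π.sum_range_d hP hH]
  refine sum_range_le_min_of_level (M := (π.Su - π.Sl) * π.ηd / π.Δ)
    (y := fun k => (s (t - 1 + k) - π.Sl) * π.ηd / π.Δ) hP ?_ ?_ ?_ ?_ ?_
  · have := π.shi_le hs2 (t - 1)
    gcongr
  · intro k hk
    have : 0 ≤ s (t - 1 + k) - π.Sl := by
      linarith [(hfeas.soc_mem hs1 hs2 (show t - 1 + k ≤ T by omega)).1]
    positivity
  · intro k hk
    have := (hfeas.soc_mem hs1 hs2 (show t - 1 + k ≤ T by omega)).2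
    gcongr
  · rw [add_zero]
    gcongr
  · intro k hk
    obtain ⟨i, hi⟩ : ∃ i, t - 1 + k = i := ⟨_, rfl⟩
    have hi1 : t + k = i + 1 := by omega
    have hiT : i + 1 ≤ T := by omega
    simp only [← add_assoc, hi, hi1]
    rcases hfeas.discharge_or_charge hiT with ⟨h1, -, -, -, h2⟩ | ⟨h1, h2, h3, -, h4⟩
    · left
      rw [h1, mul_zero, add_zero]
      refine ⟨hfeas.discharge_le_Pde hΔ hηd hPd hs1 hs2 hiT, le_of_eq ?_⟩
      rw [h2]
      field_simp
      ring
    · rw [h1, h2, zero_add, mul_one, BatteryParams.ρd, hi1]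
      have hpc := hfeas.charge_le_Pcet hΔ hηc hηd hPd hPc hs1 hs2 hiT
      rcases max_choice (-(π.ηd * π.ηc * π.Pcet (i + 1)))
        ((∑ j ∈ Finset.Icc k tb, π.d t j) - ∑ j ∈ Finset.range (tb - k), π.dbar j) with h | h
      · left
        have hle : π.ηd * π.ηc * pc (i + 1) ≤ π.ηd * π.ηc * π.Pcet (i + 1) := by gcongr
        have hnn : 0 ≤ π.ηd * π.ηc * pc (i + 1) := by positivity
        have hy : (s i - π.Sl) * π.ηd / π.Δ - (s (i + 1) - π.Sl) * π.ηd / π.Δ =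
            -(π.ηd * π.ηc * pc (i + 1)) := by
          rw [h4]
          field_simp
          ring
        rw [h, hy]
        constructor <;> linarith
      · right
        have hIcc : Finset.Icc k tb = Finset.Ico k (tb + 1) := by
          ext j
          simp only [Finset.mem_Icc, Finset.mem_Ico]
          omega
        rw [h, hIcc, Finset.sum_Ico_eq_sub _ hk.le, π.sum_range_d hP hH, π.sum_range_d hP hH,
          π.sum_range_dbar hP hM, Nat.add_sub_cancel]
end

section
/- The convex hull of E equals the restriction of the epigraph of the parabolic cylinder to the nonnegative orthant in the power variables: convexHull(E) = { (z, p^d, p^c) ∈ ℝ³ : p^d ≥ 0, p^c ≥ 0, z ≥ (p^d)² + (p^c)² + 2 p^d p^c − 2 p^d p^s + 2 p^c p^s + (p^s)² }. -/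
/-- The disjunctive set `E` of Theorem 2, with coordinates `(z, p^d, p^c)`. -/
def batteryE (ps : ℝ) : Set (ℝ × ℝ × ℝ) :=
  {q | 0 ≤ q.2.1 ∧ 0 ≤ q.2.2 ∧ q.2.1 * q.2.2 = 0 ∧
    q.2.1 ^ 2 + q.2.2 ^ 2 - 2 * q.2.1 * ps + 2 * q.2.2 * ps + ps ^ 2 ≤ q.1}

/-- Theorem 2: the convex hull of `E` is the restriction of the epigraph of the
parabolic cylinder to the nonnegative orthant in the power variables. -/
theorem convexHull_batteryE (ps : ℝ) :
    convexHull ℝ (batteryE ps) =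
      {q : ℝ × ℝ × ℝ | 0 ≤ q.2.1 ∧ 0 ≤ q.2.2 ∧
        q.2.1 ^ 2 + q.2.2 ^ 2 + 2 * q.2.1 * q.2.2 - 2 * q.2.1 * ps +
            2 * q.2.2 * ps + ps ^ 2 ≤ q.1} := by
  apply Set.Subset.antisymm
  · apply convexHull_min
    · rintro ⟨z, d, c⟩ ⟨hd, hc, hdc, hz⟩
      refine ⟨hd, hc, ?_⟩
      dsimp only at *
      linarith
    · rintro ⟨z₁, d₁, c₁⟩ ⟨hd₁, hc₁, hz₁⟩ ⟨z₂, d₂, c₂⟩ ⟨hd₂, hc₂, hz₂⟩ a b ha hb hab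
      simp only [Set.mem_ofPred_eq, Prod.smul_mk, Prod.mk_add_mk, smul_eq_mul] at *
      refine ⟨by positivity, by positivity, ?_⟩
      obtain rfl : b = 1 - a := by linarith
      have h₁ := mul_le_mul_of_nonneg_left hz₁ ha
      have h₂ := mul_le_mul_of_nonneg_left hz₂ hb
      have h₃ := mul_nonneg (mul_nonneg ha hb) (sq_nonneg (d₁ + c₁ - d₂ - c₂))
      linarith
  · rintro ⟨z, d, c⟩ ⟨hd, hc, hz⟩
    dsimp only at hd hc hz
    rcases (add_nonneg hd hc).eq_or_lt' with hs | hs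
    · apply subset_convexHull
      have hd' : d = 0 := by linarith
      have hc' : c = 0 := by linarith
      subst hd' hc'
      refine ⟨le_rfl, le_rfl, by simp, ?_⟩
      dsimp only
      linarith
    · have hx : (z + 2 * d * ps - 2 * c * ps - 2 * (d + c) * ps, d + c, (0 : ℝ)) ∈
          batteryE ps := by
        refine ⟨hs.le, le_rfl, by simp, ?_⟩
        dsimp only
        linarith
      have hy : (z + 2 * d * ps - 2 * c * ps + 2 * (d + c) * ps, (0 : ℝ), d + c) ∈
          batteryE ps := by
        refine ⟨le_rfl, hs.le, by simp, ?_⟩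
        dsimp only
        linarith
      have hmem := convex_convexHull ℝ (batteryE ps) (subset_convexHull ℝ _ hx)
        (subset_convexHull ℝ _ hy) (div_nonneg hd hs.le) (div_nonneg hc hs.le)
        (by rw [← add_div, div_self hs.ne'])
      convert hmem using 1
      simp only [Prod.smul_mk, Prod.mk_add_mk, smul_eq_mul, Prod.mk.injEq]
      refine ⟨?_, ?_, ?_⟩ <;> field_simp <;> ring
end

section
/- Every point of the cylinder epigraph lies in the convex hull of E: if p^d ≥ 0, p^c ≥ 0 and z ≥ (p^d)² + (p^c)² + 2 p^d p^c − 2 p^d p^s + 2 p^c p^s + (p^s)², then (z, p^d, p^c) ∈ convexHull(E). Moreover, when p^d + p^c > 0, setting p₀ = p^d + p^c and λ = p^d/(p^d + p^c), the point (z, p^d, p^c) equals λ·(q_d + α, p₀, 0) + (1−λ)·(q_c + α, 0, p₀), where q_d = p₀² − 2 p₀ p^s + (p^s)², q_c = p₀² + 2 p₀ p^s + (p^s)², α = z − λ q_d − (1−λ) q_c ≥ 0, and both points (q_d + α, p₀, 0) and (q_c + α, 0, p₀) belong to E. -/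
/-- The explicit convex combination of two points of `batteryE ps` that gives a point of the
cylinder epigraph with `0 < pd + pc`. -/
theorem batteryE_convex_combination (ps pd pc z : ℝ)
    (hz : pd ^ 2 + pc ^ 2 + 2 * pd * pc - 2 * pd * ps + 2 * pc * ps + ps ^ 2 ≤ z)
    (hpos : 0 < pd + pc) (p0 lam qd qc α : ℝ)
    (hp0 : p0 = pd + pc) (hlam : lam = pd / (pd + pc))
    (hqd : qd = p0 ^ 2 - 2 * p0 * ps + ps ^ 2)
    (hqc : qc = p0 ^ 2 + 2 * p0 * ps + ps ^ 2)
    (hα : α = z - lam * qd - (1 - lam) * qc) :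
    0 ≤ α ∧
      ((qd + α, p0, (0 : ℝ)) ∈ batteryE ps) ∧
      ((qc + α, (0 : ℝ), p0) ∈ batteryE ps) ∧
      (z, pd, pc) = lam • ((qd + α, p0, (0 : ℝ)) : ℝ × ℝ × ℝ) +
        (1 - lam) • ((qc + α, (0 : ℝ), p0) : ℝ × ℝ × ℝ) := by
  have hmul : lam * p0 = pd := by
    rw [hlam, hp0]
    exact div_mul_cancel₀ pd hpos.ne'
  have hp0_nonneg : 0 ≤ p0 := hp0 ▸ hpos.le
  have hα_eq : α = z - (p0 ^ 2 + ps ^ 2 + 2 * ps * (p0 - 2 * pd)) := by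
    rw [hα, hqd, hqc, ← hmul]
    ring
  have hα_nonneg : 0 ≤ α := by
    rw [hα_eq, hp0]
    linarith
  refine ⟨hα_nonneg, ⟨hp0_nonneg, le_rfl, mul_zero p0, ?_⟩,
    ⟨le_rfl, hp0_nonneg, zero_mul p0, ?_⟩, ?_⟩
  · dsimp only
    linarith
  · dsimp only
    linarith
  · simp only [Prod.smul_mk, Prod.mk_add_mk, smul_eq_mul, Prod.mk.injEq]
    refine ⟨?_, ?_, ?_⟩ <;> linarith

/-- Every point of the cylinder epigraph lies in the convex hull of `E`, with an
explicit convex combination when `p^d + p^c > 0`. -/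
theorem cylinder_epigraph_subset_convexHull (ps pd pc z : ℝ)
    (hpd : 0 ≤ pd) (hpc : 0 ≤ pc)
    (hz : pd ^ 2 + pc ^ 2 + 2 * pd * pc - 2 * pd * ps + 2 * pc * ps + ps ^ 2 ≤ z) :
    (z, pd, pc) ∈ convexHull ℝ (batteryE ps) ∧
    (0 < pd + pc → ∀ p0 lam qd qc α : ℝ,
      p0 = pd + pc → lam = pd / (pd + pc) →
      qd = p0 ^ 2 - 2 * p0 * ps + ps ^ 2 →
      qc = p0 ^ 2 + 2 * p0 * ps + ps ^ 2 →
      α = z - lam * qd - (1 - lam) * qc →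
      0 ≤ α ∧
      ((qd + α, p0, (0 : ℝ)) ∈ batteryE ps) ∧
      ((qc + α, (0 : ℝ), p0) ∈ batteryE ps) ∧
      (z, pd, pc) = lam • ((qd + α, p0, (0 : ℝ)) : ℝ × ℝ × ℝ) +
        (1 - lam) • ((qc + α, (0 : ℝ), p0) : ℝ × ℝ × ℝ)) := by
  refine ⟨?_, batteryE_convex_combination ps pd pc z hz⟩
  rcases (add_nonneg hpd hpc).eq_or_lt with h | h
  · obtain rfl : pd = 0 := by linarith
    obtain rfl : pc = 0 := by linarith
    refine subset_convexHull ℝ _ ⟨le_rfl, le_rfl, mul_zero 0, ?_⟩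
    dsimp only
    linarith
  · obtain ⟨-, hd, hc, heq⟩ :=
      batteryE_convex_combination ps pd pc z hz h _ _ _ _ _ rfl rfl rfl rfl rfl
    rw [heq]
    refine convex_convexHull ℝ _ (subset_convexHull ℝ _ hd) (subset_convexHull ℝ _ hc)
      (div_nonneg hpd h.le) ?_ (add_sub_cancel _ _)
    rw [sub_nonneg, div_le_one h]
    linarith
end

section
/- The set C⁺ = { (z, p^d, p^c) ∈ ℝ³ : p^d ≥ 0, p^c ≥ 0, z ≥ (p^d)² + (p^c)² + 2 p^d p^c − 2 p^d p^s + 2 p^c p^s + (p^s)² } is convex and contains E; consequently convexHull(E) ⊆ C⁺. -/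
/-- The epigraph of the parabolic cylinder restricted to the nonnegative orthant
in the power variables. -/
def batteryCplus (ps : ℝ) : Set (ℝ × ℝ × ℝ) :=
  {q | 0 ≤ q.2.1 ∧ 0 ≤ q.2.2 ∧
    q.2.1 ^ 2 + q.2.2 ^ 2 + 2 * q.2.1 * q.2.2 - 2 * q.2.1 * ps +
        2 * q.2.2 * ps + ps ^ 2 ≤ q.1}

theorem convex_batteryCplus (ps : ℝ) : Convex ℝ (batteryCplus ps) := by
  rintro ⟨z₁, d₁, c₁⟩ ⟨hd₁, hc₁, hz₁⟩ ⟨z₂, d₂, c₂⟩ ⟨hd₂, hc₂, hz₂⟩ a b ha hb hab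
  dsimp only at hd₁ hc₁ hz₁ hd₂ hc₂ hz₂
  simp only [batteryCplus, Set.mem_ofPred_eq, Prod.smul_mk, Prod.mk_add_mk, smul_eq_mul]
  refine ⟨by positivity, by positivity, ?_⟩
  obtain rfl : b = 1 - a := by linarith
  have h₁ := mul_le_mul_of_nonneg_left hz₁ ha
  have h₂ := mul_le_mul_of_nonneg_left hz₂ hb
  have h₃ := mul_nonneg (mul_nonneg ha hb) (sq_nonneg (d₁ + c₁ - (d₂ + c₂)))
  linarith

theorem batteryE_subset_batteryCplus (ps : ℝ) : batteryE ps ⊆ batteryCplus ps := by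
  rintro ⟨z, d, c⟩ ⟨hd, hc, hdc, hz⟩
  refine ⟨hd, hc, ?_⟩
  dsimp only at hdc hz ⊢
  linarith

/-- `C⁺` is convex, contains `E`, and hence contains the convex hull of `E`. -/
theorem batteryCplus_convex_contains (ps : ℝ) :
    Convex ℝ (batteryCplus ps) ∧ batteryE ps ⊆ batteryCplus ps ∧
      convexHull ℝ (batteryE ps) ⊆ batteryCplus ps := by
  exact ⟨convex_batteryCplus ps, batteryE_subset_batteryCplus ps,
    convexHull_min (batteryE_subset_batteryCplus ps) (convex_batteryCplus ps)⟩
end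

section
/- Replacing the power caps by the effective rates leaves the storage feasible set unaltered: the set 𝒫 defined with caps (P̄^d, P̄^c) equals the set 𝒫 defined with caps (P̄^d_e, P̄^c_e). In particular, every (p^d, p^c, s) ∈ 𝒫 satisfies p^d_t ≤ P̄^d_e and p^c_t ≤ P̄^c_e for all t = 1,…,T. -/
/-- The storage feasible set `𝒫(a, b)` with discharge cap `a` and charge cap `b`. -/
def BatteryParams.FeasibleWith (π : BatteryParams) (T : ℕ) (a b : ℝ)
    (pd pc s : ℕ → ℝ) : Prop :=
  s 0 = π.s0 ∧ ∀ t, 1 ≤ t → t ≤ T →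
    0 ≤ pd t ∧ pd t ≤ a ∧ 0 ≤ pc t ∧ pc t ≤ b ∧
    π.Sl ≤ s t ∧ s t ≤ π.Su ∧
    s t = s (t - 1) + π.Δ * (π.ηc * pc t - pd t / π.ηd) ∧
    pd t * pc t = 0

namespace BatteryParams.FeasibleWith

variable {π : BatteryParams} {T : ℕ} {a b : ℝ} {pd pc s : ℕ → ℝ}

/-- The state of charge stays within its bounds at every time, including the initial one. -/
theorem soc_mem_Icc (h : π.FeasibleWith T a b pd pc s) (hs0 : π.s0 ∈ Set.Icc π.Sl π.Su)
    {t : ℕ} (ht : t ≤ T) : s t ∈ Set.Icc π.Sl π.Su := by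
  rcases Nat.eq_zero_or_pos t with rfl | ht0
  · rwa [h.1]
  · obtain ⟨-, -, -, -, hl, hu, -⟩ := h.2 t ht0 ht
    exact ⟨hl, hu⟩

/-- Discharging within one period cannot use more than the usable capacity. -/
theorem discharge_le (h : π.FeasibleWith T a b pd pc s) (hs0 : π.s0 ∈ Set.Icc π.Sl π.Su)
    (hΔ : 0 < π.Δ) (hηd : 0 < π.ηd) (hS : π.Sl ≤ π.Su) {t : ℕ} (ht1 : 1 ≤ t) (htT : t ≤ T) :
    pd t ≤ π.ηd * (π.Su - π.Sl) / π.Δ := by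
  obtain ⟨-, -, -, -, hl, -, hdyn, hcompl⟩ := h.2 t ht1 htT
  have hprev := (h.soc_mem_Icc hs0 ((Nat.sub_le t 1).trans htT)).2
  rcases mul_eq_zero.mp hcompl with h0 | h0
  · rw [h0]
    exact div_nonneg (mul_nonneg hηd.le (sub_nonneg.mpr hS)) hΔ.le
  · rw [h0, mul_zero, zero_sub, mul_neg] at hdyn
    have hcap : π.Δ * (pd t / π.ηd) ≤ π.Su - π.Sl := by linarith
    rw [← mul_div_assoc, div_le_iff₀ hηd] at hcap
    rw [le_div_iff₀ hΔ]
    linarith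

/-- Charging within one period cannot exceed the usable capacity. -/
theorem charge_le (h : π.FeasibleWith T a b pd pc s) (hs0 : π.s0 ∈ Set.Icc π.Sl π.Su)
    (hΔ : 0 < π.Δ) (hηc : 0 < π.ηc) (hS : π.Sl ≤ π.Su) {t : ℕ} (ht1 : 1 ≤ t) (htT : t ≤ T) :
    pc t ≤ (π.Su - π.Sl) / (π.Δ * π.ηc) := by
  obtain ⟨-, -, -, -, -, hu, hdyn, hcompl⟩ := h.2 t ht1 htT
  have hprev := (h.soc_mem_Icc hs0 ((Nat.sub_le t 1).trans htT)).1
  rcases mul_eq_zero.mp hcompl with h0 | h0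
  · rw [h0, zero_div, sub_zero] at hdyn
    rw [le_div_iff₀ (mul_pos hΔ hηc)]
    linarith
  · rw [h0]
    exact div_nonneg (sub_nonneg.mpr hS) (mul_pos hΔ hηc).le

/-- A feasible trajectory stays feasible for any caps that its powers respect. -/
theorem of_le {a' b' : ℝ} (h : π.FeasibleWith T a b pd pc s)
    (hcaps : ∀ t, 1 ≤ t → t ≤ T → pd t ≤ a' ∧ pc t ≤ b') :
    π.FeasibleWith T a' b' pd pc s := by
  refine ⟨h.1, fun t ht1 htT => ?_⟩
  obtain ⟨hd0, -, hc0, -, hrest⟩ := h.2 t ht1 htT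
  exact ⟨hd0, (hcaps t ht1 htT).1, hc0, (hcaps t ht1 htT).2, hrest⟩

end BatteryParams.FeasibleWith

/-- Replacing the power caps by the effective rates leaves `𝒫` unaltered; in
particular every feasible trajectory respects the effective rates. -/
theorem effective_rates_preserve_feasible_set (π : BatteryParams) (T : ℕ)
    (hT : 1 ≤ T)
    (hΔ : 0 < π.Δ) (hηc : 0 < π.ηc) (hηc1 : π.ηc ≤ 1)
    (hηd : 0 < π.ηd) (hηd1 : π.ηd ≤ 1)
    (hSl : 0 ≤ π.Sl) (hS : π.Sl < π.Su)
    (hPd : 0 ≤ π.Pd) (hPc : 0 ≤ π.Pc)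
    (hs1 : π.Sl ≤ π.s0) (hs2 : π.s0 ≤ π.Su) :
    {x : (ℕ → ℝ) × (ℕ → ℝ) × (ℕ → ℝ) |
        π.FeasibleWith T π.Pd π.Pc x.1 x.2.1 x.2.2} =
      {x : (ℕ → ℝ) × (ℕ → ℝ) × (ℕ → ℝ) |
        π.FeasibleWith T π.Pde π.Pce x.1 x.2.1 x.2.2} ∧
    ∀ pd pc s : ℕ → ℝ, π.FeasibleWith T π.Pd π.Pc pd pc s →
      ∀ t, 1 ≤ t → t ≤ T → pd t ≤ π.Pde ∧ pc t ≤ π.Pce := by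
  have hrates : ∀ pd pc s : ℕ → ℝ, π.FeasibleWith T π.Pd π.Pc pd pc s →
      ∀ t, 1 ≤ t → t ≤ T → pd t ≤ π.Pde ∧ pc t ≤ π.Pce := by
    intro pd pc s h t ht1 htT
    obtain ⟨-, hd, -, hc, -⟩ := h.2 t ht1 htT
    exact ⟨le_min hd (h.discharge_le ⟨hs1, hs2⟩ hΔ hηd hS.le ht1 htT),
      le_min hc (h.charge_le ⟨hs1, hs2⟩ hΔ hηc hS.le ht1 htT)⟩
  refine ⟨Set.ext fun x => ⟨fun h => h.of_le (hrates _ _ _ h), fun h => h.of_le ?_⟩, hrates⟩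
  intro t ht1 htT
  obtain ⟨-, hd, -, hc, -⟩ := h.2 t ht1 htT
  exact ⟨hd.trans (min_le_left _ _), hc.trans (min_le_left _ _)⟩
end

section
/- The greedy state-of-charge trajectory is monotone non-decreasing as a set function of the set of charging periods: if Ω ⊆ Ω' ⊆ 𝒯, then σ_τ(Ω) ≤ σ_τ(Ω') for every τ = −1, 0, …, τ̄. Moreover, σ_τ(Ω) ∈ [S̲, S̄] for every τ and every Ω ⊆ 𝒯. -/
namespace BatParams

theorem σtraj_mem_Icc (π : BatParams) (hc : 0 ≤ π.Δ * π.ηc * π.Pce)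
    (hd : 0 ≤ π.Δ * π.Pde / π.ηd) (hs : π.sstar ∈ Set.Icc π.Sl π.Su)
    (Ω : Finset ℕ) (k : ℕ) : π.σtraj Ω k ∈ Set.Icc π.Sl π.Su := by
  have hS : π.Sl ≤ π.Su := hs.1.trans hs.2
  induction k with
  | zero => exact hs
  | succ k ih =>
    obtain ⟨hl, hu⟩ := ih
    rw [σtraj]
    split_ifs
    · exact ⟨le_min (by linarith) hS, min_le_right _ _⟩
    · exact ⟨le_max_right _ _, max_le (by linarith) hS⟩

theorem σtraj_mono (π : BatParams) (hc : 0 ≤ π.Δ * π.ηc * π.Pce)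
    (hd : 0 ≤ π.Δ * π.Pde / π.ηd) (hs : π.sstar ∈ Set.Icc π.Sl π.Su) :
    Monotone π.σtraj := by
  intro Ω Ω' hΩ k
  induction k with
  | zero => exact le_rfl
  | succ k ih =>
    have hu := (π.σtraj_mem_Icc hc hd hs Ω k).2
    have hl := (π.σtraj_mem_Icc hc hd hs Ω' k).1
    rw [σtraj, σtraj]
    split_ifs with h h'
    · gcongr
    · exact absurd (hΩ h) h'
    · exact max_le (le_min (by linarith) (by linarith))
        (le_min (by linarith) (hs.1.trans hs.2))
    · gcongr

end BatParams

/-- The greedy state-of-charge trajectory is monotone non-decreasing in the set of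
charging periods, and stays within `[S̲, S̄]`.  Here `σtraj Ω k` is `σ_{k-1}(Ω)`,
so `k` ranges over `0, 1, …, τ̄ + 1` (i.e. `σ_τ(Ω)` for `τ = −1, 0, …, τ̄`). -/
theorem greedy_soc_monotone (π : BatParams) (tb : ℕ)
    (hΔ : 0 < π.Δ) (hηc : 0 < π.ηc) (hηc1 : π.ηc ≤ 1)
    (hηd : 0 < π.ηd) (hηd1 : π.ηd ≤ 1) (hS : π.Sl < π.Su)
    (hPc : 0 ≤ π.Pce) (hPd : 0 ≤ π.Pde)
    (hs1 : π.Sl ≤ π.sstar) (hs2 : π.sstar ≤ π.Su) :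
    (∀ Ω Ω' : Finset ℕ, Ω ⊆ Ω' → Ω' ⊆ Finset.range (tb + 1) →
      ∀ k, k ≤ tb + 1 → π.σtraj Ω k ≤ π.σtraj Ω' k) ∧
    (∀ Ω : Finset ℕ, Ω ⊆ Finset.range (tb + 1) →
      ∀ k, k ≤ tb + 1 → π.Sl ≤ π.σtraj Ω k ∧ π.σtraj Ω k ≤ π.Su) := by
  have hc : 0 ≤ π.Δ * π.ηc * π.Pce := by positivity
  have hd : 0 ≤ π.Δ * π.Pde / π.ηd := by positivity
  exact ⟨fun _ _ hΩ _ k _ => π.σtraj_mono hc hd ⟨hs1, hs2⟩ hΩ k,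
    fun Ω _ k _ => π.σtraj_mem_Icc hc hd ⟨hs1, hs2⟩ Ω k⟩
end

section
/- For every submodular set function h on the subsets of a finite set V and all subsets A, B ⊆ V, the following inequality holds: h(B) ≤ h(A) + Σ_{j ∈ B\A} [ h((A∩B) ∪ {j}) − h(A∩B) ] − Σ_{j ∈ A\B} [ h(A) − h(A \ {j}) ]. -/
/-- A set function `h` on the subsets of a finite set `V` is submodular if for all
`A ⊆ B ⊆ V` and `j ∈ V \ B`, `h(A ∪ {j}) − h(A) ≥ h(B ∪ {j}) − h(B)`. -/
def SubmodularOn {α : Type*} [DecidableEq α] (V : Finset α)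
    (h : Finset α → ℝ) : Prop :=
  ∀ A B : Finset α, A ⊆ B → B ⊆ V → ∀ j ∈ V, j ∉ B →
    h (insert j A) - h A ≥ h (insert j B) - h B

theorem SubmodularOn.sub_le_sum_insert {α : Type*} [DecidableEq α] {V : Finset α}
    {h : Finset α → ℝ} (hsub : SubmodularOn V h) (C S : Finset α) (hCS : Disjoint C S)
    (hV : C ∪ S ⊆ V) :
    h (C ∪ S) - h C ≤ ∑ j ∈ S, (h (insert j C) - h C) := by
  induction S using Finset.induction_on with
  | empty => simp
  | insert a S ha ih =>
    rw [Finset.disjoint_insert_right] at hCS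
    rw [Finset.union_insert, Finset.insert_subset_iff] at hV
    have hstep := hsub C (C ∪ S) Finset.subset_union_left hV.2 a hV.1 (by simp [hCS.1, ha])
    have hih := ih hCS.2 hV.2
    rw [Finset.sum_insert ha, Finset.union_insert]
    linarith

theorem SubmodularOn.sum_erase_le_sub {α : Type*} [DecidableEq α] {V : Finset α}
    {h : Finset α → ℝ} (hsub : SubmodularOn V h) {A : Finset α} (hA : A ⊆ V)
    (C S : Finset α) (hCS : Disjoint C S) (hCSA : C ∪ S ⊆ A) :
    ∑ j ∈ S, (h A - h (A.erase j)) ≤ h (C ∪ S) - h C := by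
  induction S using Finset.induction_on with
  | empty => simp
  | insert a S ha ih =>
    rw [Finset.disjoint_insert_right] at hCS
    rw [Finset.union_insert, Finset.insert_subset_iff] at hCSA
    have hstep := hsub (C ∪ S) (A.erase a)
      (Finset.subset_erase.2 ⟨hCSA.2, by simp [hCS.1, ha]⟩)
      ((Finset.erase_subset a A).trans hA) a (hA hCSA.1) (Finset.notMem_erase a A)
    rw [Finset.insert_erase hCSA.1] at hstep
    have hih := ih hCS.2 hCSA.2
    rw [Finset.sum_insert ha, Finset.union_insert]
    linarith

/-- The classical submodular bound: for all `A, B ⊆ V`,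
`h(B) ≤ h(A) + Σ_{j ∈ B\A} [h((A∩B) ∪ {j}) − h(A∩B)] − Σ_{j ∈ A\B} [h(A) − h(A \ {j})]`. -/
theorem submodular_bound {α : Type*} [DecidableEq α] (V : Finset α)
    (h : Finset α → ℝ) (hsub : SubmodularOn V h)
    (A B : Finset α) (hA : A ⊆ V) (hB : B ⊆ V) :
    h B ≤ h A + (∑ j ∈ B \ A, (h (insert j (A ∩ B)) - h (A ∩ B)))
            - ∑ j ∈ A \ B, (h A - h (A.erase j)) := by
  have hBu : A ∩ B ∪ B \ A = B := by
    rw [Finset.inter_comm, Finset.union_comm, Finset.sdiff_union_inter]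
  have hAu : A ∩ B ∪ A \ B = A := by
    rw [Finset.union_comm, Finset.sdiff_union_inter]
  have hupper := hsub.sub_le_sum_insert (A ∩ B) (B \ A)
    (Finset.disjoint_sdiff.mono_left Finset.inter_subset_left) (hBu.trans_subset hB)
  have hlower := hsub.sum_erase_le_sub hA (A ∩ B) (A \ B)
    (Finset.disjoint_sdiff.mono_left Finset.inter_subset_right) hAu.subset
  rw [hBu] at hupper
  rw [hAu] at hlower
  linarith
end

section
/- Every feasible storage trajectory respects the recursive state-of-charge envelope and the tightened per-period power bounds: for every (p^d, p^c, s) ∈ 𝒫, it holds that s̲₀(t) ≤ s_t ≤ s̄₀(t) for all t = 1,…,T−1, and p^c_t ≤ c(t,0) and p^d_t ≤ d(t,0) for all t = 1,…,T. -/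
namespace BatteryParams

/-- Energy charged in a period fits in the headroom above the previous state of charge, and energy
discharged is available above the lower bound. -/
theorem Feasible.energy_le {π : BatteryParams} {T : ℕ} {pd pc s : ℕ → ℝ}
    (h : π.Feasible T pd pc s) {t : ℕ} (ht : t + 1 ≤ T)
    (hηd : 0 < π.ηd) (hl : π.Sl ≤ s t) (hu : s t ≤ π.Su) :
    pc (t + 1) * (π.Δ * π.ηc) ≤ π.Su - s t ∧ pd (t + 1) * π.Δ ≤ (s t - π.Sl) * π.ηd := by
  obtain ⟨-, -, -, -, hl', hu', hs, h0⟩ := h.2 (t + 1) (by omega) ht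
  rw [Nat.add_sub_cancel] at hs
  rcases mul_eq_zero.mp h0 with h0 | h0
  · rw [h0] at hs ⊢
    refine ⟨?_, ?_⟩
    · linear_combination hu' - hs
    · rw [zero_mul]
      exact mul_nonneg (by linarith) hηd.le
  · rw [h0] at hs ⊢
    refine ⟨by linarith, ?_⟩
    have hmul : π.Δ * (pd (t + 1) / π.ηd) ≤ s t - π.Sl := by linarith
    calc pd (t + 1) * π.Δ = π.Δ * (pd (t + 1) / π.ηd) * π.ηd := by field_simp
      _ ≤ (s t - π.Sl) * π.ηd := by gcongr

/-- The state of charge stays within its bounds, including at the initial time. -/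
theorem Feasible.bounds_s17 {π : BatteryParams} {T : ℕ} {pd pc s : ℕ → ℝ}
    (h : π.Feasible T pd pc s) (hs1 : π.Sl ≤ π.s0) (hs2 : π.s0 ≤ π.Su) {t : ℕ} (ht : t ≤ T) :
    π.Sl ≤ s t ∧ s t ≤ π.Su := by
  rcases t with _ | t
  · rw [h.1]
    exact ⟨hs1, hs2⟩
  · obtain ⟨-, -, -, -, hl, hu, -, -⟩ := h.2 (t + 1) (by omega) ht
    exact ⟨hl, hu⟩

/-- Feasible powers obey the effective rates. -/
theorem Feasible.power_le {π : BatteryParams} {T : ℕ} {pd pc s : ℕ → ℝ}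
    (h : π.Feasible T pd pc s) (hΔ : 0 < π.Δ) (hηc : 0 < π.ηc) (hηd : 0 < π.ηd)
    (hs1 : π.Sl ≤ π.s0) (hs2 : π.s0 ≤ π.Su) {t : ℕ} (ht : t + 1 ≤ T) :
    pc (t + 1) ≤ π.Pce ∧ pd (t + 1) ≤ π.Pde := by
  obtain ⟨hl, hu⟩ := h.bounds_s17 hs1 hs2 (Nat.le_of_succ_le ht)
  obtain ⟨hc, hd⟩ := h.energy_le ht hηd hl hu
  obtain ⟨-, hPd, -, hPc, -⟩ := h.2 (t + 1) (by omega) ht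
  refine ⟨le_min hPc ?_, le_min hPd ?_⟩
  · rw [le_div_iff₀ (by positivity)]
    linarith
  · rw [le_div_iff₀ hΔ]
    nlinarith

/-- The recursive envelope contains every feasible state of charge. -/
theorem Feasible.envelope {π : BatteryParams} {T : ℕ} {pd pc s : ℕ → ℝ}
    (h : π.Feasible T pd pc s) (hΔ : 0 < π.Δ) (hηc : 0 < π.ηc) (hηd : 0 < π.ηd)
    (hs1 : π.Sl ≤ π.s0) (hs2 : π.s0 ≤ π.Su) {t : ℕ} (ht : t ≤ T) :
    π.slo t ≤ s t ∧ s t ≤ π.shi t := by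
  induction t with
  | zero => simp [slo, shi, h.1]
  | succ t ih =>
    obtain ⟨ihl, ihu⟩ := ih (Nat.le_of_succ_le ht)
    obtain ⟨hc, hd⟩ := h.power_le hΔ hηc hηd hs1 hs2 ht
    obtain ⟨hd0, -, hc0, -, hl, hu, hs, -⟩ := h.2 (t + 1) (by omega) ht
    rw [Nat.add_sub_cancel] at hs
    have hs' : s (t + 1) = s t + π.Δ * π.ηc * pc (t + 1) - π.Δ / π.ηd * pd (t + 1) := by
      rw [hs]
      ring
    have hc' : π.Δ * π.ηc * pc (t + 1) ≤ π.Δ * π.ηc * π.Pce := by gcongr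
    have hd' : π.Δ / π.ηd * pd (t + 1) ≤ π.Δ / π.ηd * π.Pde := by gcongr
    have hc0' : 0 ≤ π.Δ * π.ηc * pc (t + 1) := by positivity
    have hd0' : 0 ≤ π.Δ / π.ηd * pd (t + 1) := by positivity
    exact ⟨max_le (by linarith) hl, le_min (by linarith) hu⟩

end BatteryParams

/-- Every feasible storage trajectory respects the recursive state-of-charge
envelope and the tightened per-period power bounds. -/
theorem feasible_respects_envelope (π : BatteryParams) (T : ℕ) (hT : 1 ≤ T)
    (hΔ : 0 < π.Δ) (hηc : 0 < π.ηc) (hηc1 : π.ηc ≤ 1)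
    (hηd : 0 < π.ηd) (hηd1 : π.ηd ≤ 1)
    (hSl : 0 ≤ π.Sl) (hS : π.Sl < π.Su)
    (hPd : 0 ≤ π.Pd) (hPc : 0 ≤ π.Pc)
    (hs1 : π.Sl ≤ π.s0) (hs2 : π.s0 ≤ π.Su)
    (pd pc s : ℕ → ℝ) (hfeas : π.Feasible T pd pc s) :
    (∀ t, 1 ≤ t → t ≤ T - 1 → π.slo t ≤ s t ∧ s t ≤ π.shi t) ∧
    (∀ t, 1 ≤ t → t ≤ T → pc t ≤ π.c t 0 ∧ pd t ≤ π.d t 0) := by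
  refine ⟨fun t _ ht => hfeas.envelope hΔ hηc hηd hs1 hs2 (by omega), fun t ht1 ht => ?_⟩
  obtain ⟨t, rfl⟩ := Nat.exists_eq_add_of_le' ht1
  obtain ⟨hl, hu⟩ := hfeas.bounds_s17 hs1 hs2 (Nat.le_of_succ_le ht)
  obtain ⟨hlo, hhi⟩ := hfeas.envelope hΔ hηc hηd hs1 hs2 (Nat.le_of_succ_le ht)
  obtain ⟨hc, hd⟩ := hfeas.power_le hΔ hηc hηd hs1 hs2 ht
  obtain ⟨hce, hde⟩ := hfeas.energy_le ht hηd hl hu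
  simp only [BatteryParams.c, BatteryParams.d, Nat.add_sub_cancel, Nat.cast_zero, zero_mul,
    sub_zero]
  refine ⟨le_min hc (le_max_of_le_left ?_), le_min hd (le_max_of_le_left ?_)⟩
  · rw [le_div_iff₀ (by positivity)]
    linarith
  · rw [le_div_iff₀ hΔ]
    nlinarith
end
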